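/- Let n ≥ 2, μ ∈ Δ, and K ∈ 𝒦. If f and g are finite linear combinations of characteristic functions of closed balls in ℝⁿ, then the limit lim_{ε→0} ∫ T^ε_{μ,K} f(x) g(x) dμ(x) exists and is finite. -/

import Mathlib

open MeasureTheory Metric ENNReal Filter Set Topology

noncomputable section

/-- The truncated singular integral operator `T^ε_{μ,K}`. -/
def trunc {n : ℕ} (μ : Measure (EuclideanSpace ℝ (Fin n)))
    (K : EuclideanSpace ℝ (Fin n) → ℝ) (ε : ℝ)
    (g : EuclideanSpace ℝ (Fin n) → ℝ) (x : EuclideanSpace ℝ (Fin n)) : ℝ :=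
  ∫ y in (closedBall x ε)ᶜ, K (x - y) * g y ∂μ

/-! ### Almost orthogonality for skew operators -/

section AlmostOrthogonality

variable {ι V : Type*} [NormedAddCommGroup V] [NormedSpace ℝ V]

/-- The sum of `F` over all lists of length `p`. -/
def sumLists (ι : Type*) [Fintype ι] : ℕ → (List ι → ℝ) → ℝ
  | 0, F => F []
  | p + 1, F => ∑ x : ι, sumLists ι p (fun L => F (x :: L))

lemma sumLists_mono [Fintype ι] (p : ℕ) : ∀ {F G : List ι → ℝ}, (∀ L, F L ≤ G L) →
    sumLists ι p F ≤ sumLists ι p G := by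
  induction p with
  | zero => intro F G h; exact h []
  | succ p ih => intro F G h; exact Finset.sum_le_sum fun x _ => ih fun L => h _

lemma sumLists_const_mul [Fintype ι] (p : ℕ) (c : ℝ) : ∀ F : List ι → ℝ,
    sumLists ι p (fun L => c * F L) = c * sumLists ι p F := by
  induction p with
  | zero => intro F; rfl
  | succ p ih => intro F; simp only [sumLists, ih, Finset.mul_sum]

/-- The product of `γ` over consecutive entries of a list. -/
def chainWeight (γ : ι → ι → ℝ) : List ι → ℝ
  | [] => 1
  | [_] => 1
  | x :: y :: L => γ x y * chainWeight γ (y :: L)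

/-- The product of `γ` over disjoint consecutive pairs, with a factor `A` for a leftover entry. -/
def pairWeight (γ : ι → ι → ℝ) (A : ℝ) : List ι → ℝ
  | [] => 1
  | [_] => A
  | x :: y :: L => γ x y * pairWeight γ A L

lemma sumLists_chainWeight_le [Fintype ι] {γ : ι → ι → ℝ} (hγ : ∀ i j, 0 ≤ γ i j) {Λ : ℝ}
    (hΛ : ∀ i, ∑ j, γ i j ≤ Λ) (hΛ0 : 0 ≤ Λ) (p : ℕ) (x : ι) :
    sumLists ι p (fun L => chainWeight γ (x :: L)) ≤ Λ ^ p := by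
  induction p generalizing x with
  | zero => simp [sumLists, chainWeight]
  | succ p ih =>
    simp only [sumLists, chainWeight, sumLists_const_mul]
    calc ∑ y, γ x y * sumLists ι p (fun L => chainWeight γ (y :: L))
        ≤ ∑ y, γ x y * Λ ^ p := Finset.sum_le_sum fun y _ =>
          mul_le_mul_of_nonneg_left (ih y) (hγ _ _)
      _ = (∑ y, γ x y) * Λ ^ p := by rw [Finset.sum_mul]
      _ ≤ Λ * Λ ^ p := by gcongr; exact hΛ x
      _ = Λ ^ (p + 1) := by ring

lemma norm_mul_sum_pow_le [Fintype ι] (T : ι → V →L[ℝ] V) (p : ℕ) : ∀ Q : V →L[ℝ] V,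
    ‖Q * (∑ i, T i) ^ p‖ ≤ sumLists ι p (fun L => ‖Q * (L.map T).prod‖) := by
  induction p with
  | zero => intro Q; simp [sumLists]
  | succ p ih =>
    intro Q
    have : Q * (∑ i, T i) ^ (p + 1) = ∑ x, (Q * T x) * (∑ i, T i) ^ p := by
      rw [pow_succ', ← mul_assoc, Finset.mul_sum, Finset.sum_mul]
    rw [this]
    refine (norm_sum_le _ _).trans (Finset.sum_le_sum fun x _ => (ih _).trans (le_of_eq ?_))
    simp only [List.map_cons, List.prod_cons, mul_assoc]

lemma pairWeight_nonneg {γ : ι → ι → ℝ} (hγ : ∀ i j, 0 ≤ γ i j) {A : ℝ} (hA : 0 ≤ A) :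
    ∀ L : List ι, 0 ≤ pairWeight γ A L
  | [] => zero_le_one
  | [_] => hA
  | x :: y :: L => mul_nonneg (hγ x y) (pairWeight_nonneg hγ hA L)

lemma chainWeight_nonneg {γ : ι → ι → ℝ} (hγ : ∀ i j, 0 ≤ γ i j) :
    ∀ L : List ι, 0 ≤ chainWeight γ L
  | [] => zero_le_one
  | [_] => zero_le_one
  | x :: y :: L => mul_nonneg (hγ x y) (chainWeight_nonneg hγ (y :: L))

lemma norm_prod_le_pairWeight {T : ι → V →L[ℝ] V} {γ : ι → ι → ℝ} {A : ℝ}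
    (hγ : ∀ i j, 0 ≤ γ i j) (hT : ∀ i, ‖T i‖ ≤ A) (hTT : ∀ i j, ‖T i * T j‖ ≤ γ i j ^ 2) :
    ∀ L : List ι, ‖(L.map T).prod‖ ≤ pairWeight (fun i j => γ i j ^ 2) A L
  | [] => ContinuousLinearMap.norm_id_le (𝕜 := ℝ) (E := V)
  | [x] => by simpa [pairWeight] using hT x
  | x :: y :: L => by
    rw [List.map_cons, List.map_cons, List.prod_cons, List.prod_cons, ← mul_assoc]
    exact (norm_mul_le _ _).trans (mul_le_mul (hTT x y) (norm_prod_le_pairWeight hγ hT hTT L)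
      (norm_nonneg _) (sq_nonneg _))

lemma pairWeight_mul_pairWeight {γ : ι → ι → ℝ} {A : ℝ} :
    ∀ (x : ι) (L : List ι), A * pairWeight (fun i j => γ i j ^ 2) A L *
      pairWeight (fun i j => γ i j ^ 2) A (x :: L) = (A * chainWeight γ (x :: L)) ^ 2
  | x, [] => by simp [pairWeight, chainWeight]; ring
  | x, y :: L => by
    have := pairWeight_mul_pairWeight (γ := γ) (A := A) y L
    simp only [chainWeight]
    rw [pairWeight]
    linear_combination (γ x y) ^ 2 * this

lemma norm_prod_cons_le {T : ι → V →L[ℝ] V} {γ : ι → ι → ℝ} {A : ℝ} (hA : 0 ≤ A)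
    (hγ : ∀ i j, 0 ≤ γ i j) (hT : ∀ i, ‖T i‖ ≤ A) (hTT : ∀ i j, ‖T i * T j‖ ≤ γ i j ^ 2)
    (x : ι) (L : List ι) :
    ‖((x :: L).map T).prod‖ ≤ A * chainWeight γ (x :: L) := by
  have h1 := norm_prod_le_pairWeight hγ hT hTT (x :: L)
  have h2 : ‖((x :: L).map T).prod‖ ≤ A * pairWeight (fun i j => γ i j ^ 2) A L := by
    rw [List.map_cons, List.prod_cons]
    exact (norm_mul_le _ _).trans (mul_le_mul (hT x) (norm_prod_le_pairWeight hγ hT hTT L)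
      (norm_nonneg _) hA)
  refine le_of_sq_le_sq ?_ (mul_nonneg hA (chainWeight_nonneg hγ _))
  rw [← pairWeight_mul_pairWeight, sq]
  exact mul_le_mul h2 h1 (norm_nonneg _) ((norm_nonneg _).trans h2)

lemma norm_sum_pow_succ_le [Fintype ι] {T : ι → V →L[ℝ] V} {γ : ι → ι → ℝ} {A Λ : ℝ} (hA : 0 ≤ A)
    (hγ : ∀ i j, 0 ≤ γ i j) (hT : ∀ i, ‖T i‖ ≤ A) (hTT : ∀ i j, ‖T i * T j‖ ≤ γ i j ^ 2)
    (hΛ : ∀ i, ∑ j, γ i j ≤ Λ) (hΛ0 : 0 ≤ Λ) (p : ℕ) :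
    ‖(∑ i, T i) ^ (p + 1)‖ ≤ Fintype.card ι * A * Λ ^ p := by
  have h := norm_mul_sum_pow_le T (p + 1) 1
  simp only [one_mul] at h
  refine h.trans ?_
  calc sumLists ι (p + 1) (fun L => ‖(L.map T).prod‖)
      ≤ ∑ _x : ι, A * Λ ^ p := Finset.sum_le_sum fun x _ => by
        refine (sumLists_mono p fun L => norm_prod_cons_le hA hγ hT hTT x L).trans ?_
        rw [sumLists_const_mul]
        exact mul_le_mul_of_nonneg_left (sumLists_chainWeight_le hγ hΛ hΛ0 p x) hA
    _ = _ := by simp [mul_assoc]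

/-- If `S` is skew for a nonnegative symmetric form `B` dominated by the norm and the powers of `S`
grow at most like `D * Λ ^ p`, then `S` has `B`-seminorm at most `Λ`. -/
lemma skew_form_le (B : V →ₗ[ℝ] V →ₗ[ℝ] ℝ) (hB0 : ∀ f, 0 ≤ B f f)
    (hBs : ∀ f g, B f g = B g f) {M : ℝ} (hM : ∀ f, B f f ≤ M * ‖f‖ ^ 2)
    (S : V →L[ℝ] V) (hS : ∀ f g, B (S f) g = -B f (S g)) {D Λ : ℝ} (hΛ : 0 < Λ) (hM0 : 0 ≤ M)
    (hpow : ∀ p, ‖S ^ (p + 1)‖ ≤ D * Λ ^ p) (f : V) :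
    B (S f) (S f) ≤ Λ ^ 2 * B f f := by
  have cs : ∀ f g, B f g ^ 2 ≤ B f f * B g g := fun f g => by
    have := LinearMap.BilinForm.apply_mul_apply_le_of_forall_zero_le B hB0 f g
    rwa [hBs g f, ← sq] at this
  set a : ℕ → ℝ := fun p => B ((S ^ p) f) ((S ^ p) f) with ha
  have hstep : ∀ p (f : V), (S ^ (p + 1)) f = S ((S ^ p) f) := fun p f => by
    rw [pow_succ']; rfl
  have hconv : ∀ p, a (p + 1) ^ 2 ≤ a p * a (p + 2) := fun p => by
    have h1 : a (p + 1) = -B ((S ^ p) f) ((S ^ (p + 2)) f) := by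
      simp only [ha]
      rw [hstep (p + 1), ← hS, ← hstep]
    rw [h1, neg_sq]
    exact cs _ _
  have ha0 : ∀ p, 0 ≤ a p := fun p => hB0 _
  have hbd : ∀ p, a (p + 1) ≤ (M * D ^ 2 * ‖f‖ ^ 2) * (Λ ^ 2) ^ p := fun p => by
    have h1 : ‖(S ^ (p + 1)) f‖ ≤ D * Λ ^ p * ‖f‖ :=
      (ContinuousLinearMap.le_opNorm _ _).trans (by gcongr; exact hpow p)
    calc a (p + 1) ≤ M * ‖(S ^ (p + 1)) f‖ ^ 2 := hM _
      _ ≤ M * (D * Λ ^ p * ‖f‖) ^ 2 := by gcongr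
      _ = _ := by ring
  have e0 : a 0 = B f f := by simp [ha]
  have e1 : a 1 = B (S f) (S f) := by simp [ha]
  rw [← e0, ← e1]
  by_contra! hlt
  have ha1 : 0 < a 1 := lt_of_le_of_lt (by have := ha0 0; positivity) hlt
  have ha00 : 0 < a 0 := by
    rcases (ha0 0).eq_or_lt with h | h
    · have := hconv 0
      simp only [zero_add, ← h, zero_mul] at this
      nlinarith
    · exact h
  have hmono : ∀ p, 0 < a p ∧ a 1 / a 0 * a p ≤ a (p + 1) := fun p => by
    induction p with
    | zero => exact ⟨ha00, by simp [div_mul_cancel₀ _ ha00.ne']⟩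
    | succ p ih =>
      obtain ⟨hp, hp'⟩ := ih
      have hpos : 0 < a (p + 1) := lt_of_lt_of_le (by positivity) hp'
      refine ⟨hpos, ?_⟩
      have h1 : a 1 / a 0 * a (p + 1) * a p ≤ a (p + 2) * a p := by
        calc _ = (a 1 / a 0 * a p) * a (p + 1) := by ring
          _ ≤ a (p + 1) * a (p + 1) := by gcongr
          _ ≤ a (p + 2) * a p := by have := hconv p; nlinarith
      exact le_of_mul_le_mul_right h1 hp
  have hgeom : ∀ p, (a 1 / a 0) ^ p * a 1 ≤ a (p + 1) := fun p => by
    induction p with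
    | zero => simp
    | succ p ih =>
      calc _ = a 1 / a 0 * ((a 1 / a 0) ^ p * a 1) := by ring
        _ ≤ a 1 / a 0 * a (p + 1) := by gcongr
        _ ≤ _ := (hmono (p + 1)).2
  have hρ : 1 < (a 1 / a 0) / Λ ^ 2 := by
    rw [lt_div_iff₀ (by positivity), lt_div_iff₀ ha00]; linarith
  obtain ⟨p, hp⟩ := pow_unbounded_of_one_lt ((M * D ^ 2 * ‖f‖ ^ 2) / a 1) hρ
  rw [div_lt_iff₀ ha1, div_pow, div_mul_eq_mul_div, lt_div_iff₀ (by positivity)] at hp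
  exact absurd ((hgeom p).trans (hbd p)) (not_le.2 hp)

end AlmostOrthogonality

/-! ### Dyadic pieces of a kernel -/

section KernelPieces

/-- A Lipschitz cutoff vanishing on `(-∞, 1]` and equal to `1` on `[2, ∞)`. -/
def ramp (s : ℝ) : ℝ := max 0 (min 1 (s - 1))

lemma ramp_of_le {s : ℝ} (h : s ≤ 1) : ramp s = 0 := by
  rw [ramp, max_eq_left]; exact (min_le_right _ _).trans (by linarith)

lemma ramp_of_ge {s : ℝ} (h : 2 ≤ s) : ramp s = 1 := by
  rw [ramp, min_eq_left (by linarith), max_eq_right zero_le_one]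

lemma ramp_nonneg (s : ℝ) : 0 ≤ ramp s := le_max_left _ _

lemma ramp_le_one (s : ℝ) : ramp s ≤ 1 := max_le zero_le_one (min_le_left _ _)

lemma abs_ramp_sub_le (s t : ℝ) : |ramp s - ramp t| ≤ |s - t| := by
  unfold ramp
  refine (abs_max_sub_max_le_max _ _ _ _).trans (max_le (by simp) ?_)
  refine (abs_min_sub_min_le_max _ _ _ _).trans (max_le (by simp) ?_)
  rw [sub_sub_sub_cancel_right]

variable {E : Type*} [NormedAddCommGroup E]

/-- The part of the kernel `K` living at distances between `r` and `4 * r`. -/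
def kernelPiece (K : E → ℝ) (r : ℝ) (x : E) : ℝ :=
  (ramp (‖x‖ / r) - ramp (‖x‖ / (2 * r))) * K x

/-- A family of odd Lipschitz kernels, the one with index `r` being adapted to the scale `r`
in dimension `m`. -/
structure IsPieceFamily (m : ℕ) (A : ℝ) (κ : ℝ → E → ℝ) : Prop where
  odd : ∀ r x, κ r (-x) = -κ r x
  supp : ∀ r x, 0 < r → κ r x ≠ 0 → r ≤ ‖x‖ ∧ ‖x‖ ≤ 4 * r
  bound : ∀ r x, 0 < r → |κ r x| ≤ A / r ^ m
  lip : ∀ r x y, 0 < r → |κ r x - κ r y| ≤ A * ‖x - y‖ / r ^ (m + 1)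

lemma sum_kernelPiece (K : E → ℝ) (ε : ℝ) (N : ℕ) (x : E) :
    ∑ j ∈ Finset.range N, kernelPiece K (ε * 2 ^ j) x =
      (ramp (‖x‖ / ε) - ramp (‖x‖ / (ε * 2 ^ N))) * K x := by
  induction N with
  | zero => simp
  | succ N ih =>
    rw [Finset.sum_range_succ, ih, kernelPiece, show 2 * (ε * 2 ^ N) = ε * 2 ^ (N + 1) by ring]
    ring

lemma isPieceFamily_kernelPiece [NormedSpace ℝ E] {m : ℕ} {K : E → ℝ} {C : ℝ}
    (hodd : ∀ x, x ≠ 0 → K (-x) = -K x) (hK : ∀ x, x ≠ 0 → |K x| ≤ C / ‖x‖ ^ m)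
    (hd : ∀ x, x ≠ 0 → DifferentiableAt ℝ K x)
    (hgrad : ∀ x, x ≠ 0 → ‖fderiv ℝ K x‖ ≤ C / ‖x‖ ^ (m + 1)) (hC : 0 ≤ C) :
    IsPieceFamily m (C * (4 + 2 ^ (m + 1))) (kernelPiece K) := by
  have hsupp : ∀ r x, 0 < r → kernelPiece K r x ≠ 0 → r ≤ ‖x‖ ∧ ‖x‖ ≤ 4 * r := by
    intro r x hr h
    constructor
    · by_contra! hx
      refine h ?_
      rw [kernelPiece, ramp_of_le, ramp_of_le]
      · simp
      · rw [div_le_one (by positivity)]; linarith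
      · rw [div_le_one hr]; exact hx.le
    · by_contra! hx
      refine h ?_
      rw [kernelPiece, ramp_of_ge, ramp_of_ge]
      · simp
      · rw [le_div_iff₀ (by positivity)]; linarith
      · rw [le_div_iff₀ hr]; linarith
  have hη : ∀ r (x : E), 0 < r → |ramp (‖x‖ / r) - ramp (‖x‖ / (2 * r))| ≤ 1 := fun r x hr => by
    have h1 := ramp_nonneg (‖x‖ / r); have h2 := ramp_le_one (‖x‖ / r)
    have h3 := ramp_nonneg (‖x‖ / (2 * r)); have h4 := ramp_le_one (‖x‖ / (2 * r))
    rw [abs_le]; constructor <;> linarith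
  have hbd : ∀ r x, 0 < r → |kernelPiece K r x| ≤ C / r ^ m := by
    intro r x hr
    by_cases h : kernelPiece K r x = 0
    · rw [h, abs_zero]; positivity
    have hx := (hsupp r x hr h).1
    have hx0 : x ≠ 0 := norm_pos_iff.1 (hr.trans_le hx)
    rw [kernelPiece, abs_mul]
    calc _ ≤ 1 * (C / ‖x‖ ^ m) := by gcongr; exacts [hη r x hr, hK x hx0]
      _ ≤ C / r ^ m := by rw [one_mul]; gcongr
  have hfar : ∀ r x y, 0 < r → r / 2 ≤ ‖x - y‖ →
      |kernelPiece K r x - kernelPiece K r y| ≤ 4 * C * ‖x - y‖ / r ^ (m + 1) := by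
    intro r x y hr hxy
    calc _ ≤ C / r ^ m + C / r ^ m := (abs_sub _ _).trans (add_le_add (hbd r x hr) (hbd r y hr))
      _ = 4 * C * (r / 2) / r ^ (m + 1) := by field_simp; ring
      _ ≤ _ := by gcongr
  have hnear : ∀ r x y, 0 < r → ‖x - y‖ < r / 2 → kernelPiece K r x ≠ 0 →
      |kernelPiece K r x - kernelPiece K r y| ≤ (2 + 2 ^ (m + 1)) * C * ‖x - y‖ / r ^ (m + 1) := by
    intro r x y hr hxy h
    have hx := (hsupp r x hr h).1
    have hx0 : x ≠ 0 := norm_pos_iff.1 (hr.trans_le hx)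
    have hball : ∀ w ∈ ball x (r / 2), r / 2 ≤ ‖w‖ := fun w hw => by
      have h1 := norm_sub_norm_le x w
      rw [mem_ball, dist_comm, dist_eq_norm] at hw
      linarith
    have hmv : ‖K y - K x‖ ≤ C / (r / 2) ^ (m + 1) * ‖y - x‖ := by
      refine (convex_ball x (r / 2)).norm_image_sub_le_of_norm_fderiv_le (𝕜 := ℝ) (f := K)
        (fun w hw => ?_) (fun w hw => ?_) (mem_ball_self (by positivity)) ?_
      · exact hd w (norm_pos_iff.1 ((by positivity : 0 < r / 2).trans_le (hball w hw)))
      · refine (hgrad w (norm_pos_iff.1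
          ((by positivity : 0 < r / 2).trans_le (hball w hw)))).trans ?_
        have := hball w hw
        gcongr
      · rw [mem_ball, dist_comm, dist_eq_norm]; exact hxy
    have e : kernelPiece K r x - kernelPiece K r y =
        ((ramp (‖x‖ / r) - ramp (‖y‖ / r)) - (ramp (‖x‖ / (2 * r)) - ramp (‖y‖ / (2 * r)))) * K x
        - (ramp (‖y‖ / r) - ramp (‖y‖ / (2 * r))) * (K y - K x) := by
      simp only [kernelPiece]; ring
    have hn : |‖x‖ - ‖y‖| ≤ ‖x - y‖ := abs_norm_sub_norm_le x y
    have hr1 : |ramp (‖x‖ / r) - ramp (‖y‖ / r)| ≤ ‖x - y‖ / r := by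
      refine (abs_ramp_sub_le _ _).trans ?_
      rw [← sub_div, abs_div, abs_of_pos hr]; gcongr
    have hr2 : |ramp (‖x‖ / (2 * r)) - ramp (‖y‖ / (2 * r))| ≤ ‖x - y‖ / r := by
      refine (abs_ramp_sub_le _ _).trans ?_
      rw [← sub_div, abs_div, abs_of_pos (by positivity : 0 < 2 * r)]
      gcongr; linarith
    rw [e]
    calc _ ≤ |((ramp (‖x‖ / r) - ramp (‖y‖ / r)) - (ramp (‖x‖ / (2 * r)) - ramp (‖y‖ / (2 * r))))|
            * |K x| + |ramp (‖y‖ / r) - ramp (‖y‖ / (2 * r))| * |K y - K x| := by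
          rw [← abs_mul, ← abs_mul]; exact abs_sub _ _
      _ ≤ (‖x - y‖ / r + ‖x - y‖ / r) * (C / r ^ m)
            + 1 * (C / (r / 2) ^ (m + 1) * ‖x - y‖) := by
          gcongr
          · exact (abs_sub _ _).trans (add_le_add hr1 hr2)
          · exact (hK x hx0).trans (by gcongr)
          · exact hη r y hr
          · rw [norm_sub_rev x y]; exact hmv
      _ = _ := by rw [div_pow]; field_simp; ring
  refine ⟨fun r x => ?_, hsupp, fun r x hr => (hbd r x hr).trans ?_, fun r x y hr => ?_⟩
  · rcases eq_or_ne x 0 with rfl | hx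
    · simp [kernelPiece, ramp_of_le]
    · simp [kernelPiece, hodd x hx]
  · gcongr
    have : (0 : ℝ) < 2 ^ (m + 1) := by positivity
    nlinarith
  · have hp : (0 : ℝ) < 2 ^ (m + 1) := by positivity
    rcases le_or_gt (r / 2) ‖x - y‖ with h | h
    · refine (hfar r x y hr h).trans ?_
      gcongr ?_ * _ / _
      nlinarith
    by_cases hx : kernelPiece K r x = 0
    · by_cases hy : kernelPiece K r y = 0
      · rw [hx, hy]; simp; positivity
      · rw [abs_sub_comm, norm_sub_rev x y]
        refine (hnear r y x hr (by rwa [norm_sub_rev]) hy).trans ?_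
        gcongr ?_ * _ / _
        nlinarith
    · refine (hnear r x y hr h hx).trans ?_
      gcongr ?_ * _ / _
      nlinarith

end KernelPieces

/-! ### Surface measure on a sphere -/

lemma abs_integral_le_of_support {X : Type*} [MeasurableSpace X] {σ : Measure X} [IsFiniteMeasure σ]
    {f : X → ℝ} {s : Set X} {c : ℝ} (hc : 0 ≤ c)
    (h : ∀ ω, f ω ≠ 0 → ω ∈ s ∧ |f ω| ≤ c) : |∫ ω, f ω ∂σ| ≤ c * σ.real s := by
  have h1 : ∀ ω, ω ∉ s → f ω = 0 := fun ω hω => by_contra fun h0 => hω (h ω h0).1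
  rw [← setIntegral_eq_integral_of_forall_compl_eq_zero (μ := σ) h1]
  rw [← Real.norm_eq_abs]
  refine norm_setIntegral_le_of_norm_le_const (measure_lt_top σ s) fun ω _ => ?_
  by_cases h0 : f ω = 0
  · simpa [h0] using hc
  · exact (h ω h0).2

section SphereMeasure

open scoped Pointwise

/-- A parametrized surface `z` carrying a measure `σ` which is Ahlfors regular of dimension `m`
up to scale `2 * R`, and against which the kernels `κ r` have small integrals. -/
structure IsRegularSurface {E X : Type*} [NormedAddCommGroup E] [MeasurableSpace X]
    (m : ℕ) (κ : ℝ → E → ℝ) (z : X → E) (σ : Measure X) (A a R : ℝ) : Prop where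
  upper : ∀ x r, 0 < r → σ.real {ω | ‖z ω - x‖ ≤ r} ≤ A * r ^ m
  lower : ∀ ω t, 0 < t → t ≤ 2 * R → a * t ^ m ≤ σ.real {ω' | ‖z ω' - z ω‖ ≤ t}
  cancel : ∀ ω r, 0 < r → |∫ ω', κ r (z ω - z ω') ∂σ| ≤ A * r

lemma IsPieceFamily.continuous {E : Type*} [NormedAddCommGroup E]
    {m : ℕ} {A : ℝ} {κ : ℝ → E → ℝ} (h : IsPieceFamily m A κ)
    (hA : 0 ≤ A) {r : ℝ} (hr : 0 < r) : Continuous (κ r) := by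
  refine (LipschitzWith.of_dist_le_mul (K := (A / r ^ (m + 1)).toNNReal) fun x y => ?_).continuous
  rw [Real.dist_eq, dist_eq_norm, Real.coe_toNNReal _ (by positivity)]
  exact (h.lip r x y hr).trans (le_of_eq (by ring))

variable {E : Type*} [NormedAddCommGroup E] [InnerProductSpace ℝ E]

/-- A linear isometry acts on the unit sphere. -/
def sphereMap (g : E ≃ₗᵢ[ℝ] E) (ω : sphere (0 : E) 1) : sphere (0 : E) 1 :=
  ⟨g ω, by simp⟩

lemma continuous_sphereMap (g : E ≃ₗᵢ[ℝ] E) : Continuous (sphereMap g) :=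
  Continuous.subtype_mk (g.continuous.comp continuous_subtype_val) _

/-- The reflection across a line moves a point of the sphere, up to a quadratic error, to the
point symmetric to it with respect to `ω`. -/
lemma sub_sphereMap_reflection (ω ω' : sphere (0 : E) 1) :
    (ω : E) - sphereMap (ℝ ∙ (ω : E)).reflection ω' =
      -((ω : E) - ω') + ‖(ω : E) - ω'‖ ^ 2 • (ω : E) := by
  have h1 : ‖(ω : E)‖ = 1 := by simp
  have h2 : ‖(ω' : E)‖ = 1 := by simp
  have h3 : ‖(ω : E) - ω'‖ ^ 2 = 2 - 2 * inner ℝ (ω : E) (ω' : E) := by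
    rw [norm_sub_sq_real, h1, h2]; ring
  rw [h3]
  simp only [sphereMap, Submodule.reflection_singleton_apply, h1]
  simp
  module

lemma norm_sub_sphereMap_reflection (ω ω' : sphere (0 : E) 1) :
    ‖(ω : E) - sphereMap (ℝ ∙ (ω : E)).reflection ω'‖ = ‖(ω : E) - ω'‖ := by
  have h : (ℝ ∙ (ω : E)).reflection (ω : E) = ω :=
    Submodule.reflection_mem_subspace_eq_self (Submodule.mem_span_singleton_self _)
  calc _ = ‖(ℝ ∙ (ω : E)).reflection ((ω : E) - ω')‖ := by rw [map_sub, h]; rfl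
    _ = _ := LinearIsometryEquiv.norm_map _ _

variable [FiniteDimensional ℝ E] [MeasurableSpace E] [BorelSpace E]

lemma toSphere_real_apply {s : Set (sphere (0 : E) 1)} (hs : MeasurableSet s) :
    (volume : Measure E).toSphere.real s =
      Module.finrank ℝ E * (volume : Measure E).real (Ioo (0 : ℝ) 1 • ((↑) '' s)) := by
  rw [Measure.real, Measure.toSphere_apply' _ hs, ENNReal.toReal_mul, ENNReal.toReal_natCast]; rfl

lemma measurableSet_sphere_near {E : Type*} [NormedAddCommGroup E] [MeasurableSpace E]
    [BorelSpace E]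
    (x : E) (r : ℝ) :
    MeasurableSet {ω : sphere (0 : E) 1 | ‖(ω : E) - x‖ ≤ r} :=
  (isClosed_le (by fun_prop) continuous_const).measurableSet

lemma toSphere_near_le {m : ℕ} (hm : Module.finrank ℝ E = m + 1) (ω₀ : sphere (0 : E) 1) {r : ℝ}
    (hr : 0 < r) : (volume : Measure E).toSphere.real {ω | ‖(ω : E) - ω₀‖ ≤ r} ≤
      (m + 1) * 2 ^ (m + 2) * (volume : Measure E).real (ball 0 1) * r ^ m := by
  have hω₀ : ‖(ω₀ : E)‖ = 1 := by simp
  have hV : 0 ≤ (volume : Measure E).real (ball 0 1) := measureReal_nonneg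
  rcases le_or_gt r 1 with hr1 | hr1
  · rw [toSphere_real_apply (measurableSet_sphere_near _ _), hm]
    set N := ⌊1 / r⌋₊ with hN
    have hsub : Ioo (0 : ℝ) 1 • ((↑) '' {ω : sphere (0 : E) 1 | ‖(ω : E) - ω₀‖ ≤ r}) ⊆
        ⋃ k ∈ Finset.range (N + 1), closedBall (((k : ℝ) * r) • (ω₀ : E)) (2 * r) := by
      rintro _ ⟨s, ⟨hs0, hs1⟩, _, ⟨ω, hω, rfl⟩, rfl⟩
      have hk1 : (⌊s / r⌋₊ : ℝ) ≤ s / r := Nat.floor_le (by positivity)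
      have hk2 : s / r < ⌊s / r⌋₊ + 1 := Nat.lt_floor_add_one _
      rw [le_div_iff₀ hr] at hk1
      rw [div_lt_iff₀ hr] at hk2
      refine mem_biUnion (x := ⌊s / r⌋₊) ?_ ?_
      · rw [SetLike.mem_coe, Finset.mem_range, Nat.lt_succ_iff]
        exact Nat.floor_le_floor (by gcongr)
      · rw [mem_closedBall, dist_eq_norm]
        have : s • (ω : E) - ((⌊s / r⌋₊ : ℝ) * r) • (ω₀ : E) =
            s • ((ω : E) - ω₀) + (s - ⌊s / r⌋₊ * r) • (ω₀ : E) := by module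
        calc _ ≤ s * ‖(ω : E) - ω₀‖ + |s - ⌊s / r⌋₊ * r| * 1 := by
              rw [this]
              refine (norm_add_le _ _).trans (le_of_eq ?_)
              rw [norm_smul, norm_smul, hω₀, Real.norm_of_nonneg hs0.le, Real.norm_eq_abs]
          _ ≤ 1 * r + r * 1 := by
              gcongr
              · exact hω
              · rw [abs_le]; constructor <;> nlinarith
          _ = 2 * r := by ring
    have hN1 : ((N + 1 : ℕ) : ℝ) ≤ 2 / r := by
      have : (N : ℝ) ≤ 1 / r := Nat.floor_le (by positivity)
      have h1 : 1 ≤ 1 / r := by rw [le_div_iff₀ hr]; linarith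
      push_cast
      calc (N : ℝ) + 1 ≤ 1 / r + 1 / r := by linarith
        _ = 2 / r := by ring
    have hb : (volume : Measure E).real
        (Ioo (0 : ℝ) 1 • ((↑) '' {ω : sphere (0 : E) 1 | ‖(ω : E) - ω₀‖ ≤ r})) ≤
        2 / r * ((2 * r) ^ (m + 1) * (volume : Measure E).real (ball 0 1)) := by
      refine (measureReal_mono hsub ?_).trans ((measureReal_biUnion_finset_le _ _).trans ?_)
      · exact ((measure_biUnion_lt_top (Finset.finite_toSet _)
          fun k _ => measure_closedBall_lt_top)).ne
      · simp only [Measure.addHaar_real_closedBall _ _ (by positivity : 0 ≤ 2 * r), hm,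
          Finset.sum_const, Finset.card_range, nsmul_eq_mul]
        gcongr
    calc _ ≤ ((m + 1 : ℕ) : ℝ) *
          (2 / r * ((2 * r) ^ (m + 1) * (volume : Measure E).real (ball 0 1))) := by gcongr
      _ = _ := by push_cast; field_simp; ring
  · calc _ ≤ (volume : Measure E).toSphere.real univ := measureReal_mono (subset_univ _)
      _ = (m + 1) * 1 * (volume : Measure E).real (ball 0 1) * 1 := by
        rw [Measure.toSphere_real_apply_univ, hm]; push_cast; ring
      _ ≤ _ := by gcongr <;> exact one_le_pow₀ (by linarith)

lemma le_toSphere_near {m : ℕ} (hm : Module.finrank ℝ E = m + 1) (ω₀ : sphere (0 : E) 1) {r : ℝ}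
    (hr : 0 < r) (hr2 : r ≤ 2) :
    (m + 1) * (volume : Measure E).real (ball 0 1) / 9 ^ (m + 1) * r ^ m ≤
      (volume : Measure E).toSphere.real {ω | ‖(ω : E) - ω₀‖ ≤ r} := by
  have hω₀ : ‖(ω₀ : E)‖ = 1 := by simp
  have hV : 0 ≤ (volume : Measure E).real (ball 0 1) := measureReal_nonneg
  rw [toSphere_real_apply (measurableSet_sphere_near _ _), hm]
  set N := ⌊1 / r⌋₊ with hN
  have hN1 : 1 / r ≤ ((N + 1 : ℕ) : ℝ) := by push_cast; exact (Nat.lt_floor_add_one _).le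
  have hN2 : (N : ℝ) * r ≤ 1 := by
    rw [← le_div_iff₀ hr]; exact Nat.floor_le (by positivity)
  have hsub : (⋃ k ∈ Finset.range (N + 1), closedBall ((1 / 2 + k * (r / 4)) • (ω₀ : E)) (r / 9)) ⊆
      Ioo (0 : ℝ) 1 • ((↑) '' {ω : sphere (0 : E) 1 | ‖(ω : E) - ω₀‖ ≤ r}) := by
    intro x hx
    simp only [mem_iUnion, Finset.mem_range, Nat.lt_succ_iff] at hx
    obtain ⟨k, hk, hx⟩ := hx
    set s : ℝ := 1 / 2 + k * (r / 4) with hs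
    have hk1 : (k : ℝ) * r ≤ 1 := (by gcongr : (k : ℝ) * r ≤ N * r).trans hN2
    have hk0 : 0 ≤ (k : ℝ) * r := by positivity
    have hs1 : 1 / 2 ≤ s := by linarith
    have hs2 : s ≤ 3 / 4 := by linarith
    rw [mem_closedBall, dist_eq_norm] at hx
    have hsn : ‖s • (ω₀ : E)‖ = s := by
      rw [norm_smul, hω₀, mul_one, Real.norm_of_nonneg (by linarith)]
    have habs : |‖x‖ - s| ≤ r / 9 := by
      have := abs_norm_sub_norm_le x (s • (ω₀ : E))
      rw [hsn] at this
      exact this.trans hx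
    rw [abs_le] at habs
    have hx0 : 0 < ‖x‖ := by linarith [habs.1]
    have hx1 : ‖x‖ < 1 := by linarith [habs.2]
    refine ⟨‖x‖, ⟨hx0, hx1⟩, ‖x‖⁻¹ • x, ⟨⟨‖x‖⁻¹ • x, ?_⟩, ?_, rfl⟩, ?_⟩
    · simp [norm_smul, hx0.ne']
    · have h1 : s • (‖x‖⁻¹ • x - ω₀) = (s - ‖x‖) • (‖x‖⁻¹ • x) + (x - s • (ω₀ : E)) := by
        have : ‖x‖ • ‖x‖⁻¹ • x = x := by rw [smul_smul, mul_inv_cancel₀ hx0.ne', one_smul]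
        rw [sub_smul, this]; module
      have h2 : s * ‖‖x‖⁻¹ • x - (ω₀ : E)‖ ≤ r / 9 + r / 9 := by
        calc _ = ‖s • (‖x‖⁻¹ • x - (ω₀ : E))‖ := by
              rw [norm_smul, Real.norm_of_nonneg (by linarith)]
          _ ≤ ‖(s - ‖x‖) • (‖x‖⁻¹ • x)‖ + ‖x - s • (ω₀ : E)‖ := by
              rw [h1]; exact norm_add_le _ _
          _ ≤ r / 9 + r / 9 := by
              refine add_le_add ?_ hx
              rw [norm_smul, norm_smul, norm_inv, norm_norm, inv_mul_cancel₀ hx0.ne', mul_one,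
                Real.norm_eq_abs, abs_le]
              constructor <;> linarith [habs.1, habs.2]
      show ‖‖x‖⁻¹ • x - (ω₀ : E)‖ ≤ r
      nlinarith [norm_nonneg (‖x‖⁻¹ • x - (ω₀ : E))]
    · show ‖x‖ • ‖x‖⁻¹ • x = x
      rw [smul_smul, mul_inv_cancel₀ hx0.ne', one_smul]
  have hdisj : (↑(Finset.range (N + 1)) : Set ℕ).PairwiseDisjoint
      (fun k : ℕ => closedBall ((1 / 2 + k * (r / 4)) • (ω₀ : E)) (r / 9)) := by
    intro i _ j _ hij
    apply closedBall_disjoint_closedBall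
    rw [dist_eq_norm, ← sub_smul, norm_smul, hω₀, mul_one, Real.norm_eq_abs]
    have h1 : (1 : ℝ) ≤ |(i : ℝ) - j| := by
      have : (1 : ℤ) ≤ |(i : ℤ) - j| := Int.one_le_abs (by omega)
      exact_mod_cast this
    have h2 : (1 / 2 + i * (r / 4) - (1 / 2 + j * (r / 4)) : ℝ) = (i - j) * (r / 4) := by ring
    rw [h2, abs_mul, abs_of_pos (by positivity : 0 < r / 4)]
    nlinarith
  have hb : 1 / r * ((r / 9) ^ (m + 1) * (volume : Measure E).real (ball 0 1)) ≤
      (volume : Measure E).real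
        (Ioo (0 : ℝ) 1 • ((↑) '' {ω : sphere (0 : E) 1 | ‖(ω : E) - ω₀‖ ≤ r})) := by
    refine le_trans ?_ (measureReal_mono hsub ?_)
    · rw [measureReal_biUnion_finset hdisj (fun _ _ => measurableSet_closedBall)
        (fun _ _ => measure_closedBall_lt_top.ne)]
      simp only [Measure.addHaar_real_closedBall _ _ (by positivity : 0 ≤ r / 9), hm,
        Finset.sum_const, Finset.card_range, nsmul_eq_mul]
      gcongr
    · refine ((measure_mono ?_).trans_lt (measure_ball_lt_top (x := (0 : E)) (r := 1))).ne
      rintro _ ⟨s, ⟨hs0, hs1⟩, _, ⟨ω, -, rfl⟩, rfl⟩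
      simpa [norm_smul, abs_of_pos hs0] using hs1
  calc _ = ((m + 1 : ℕ) : ℝ) *
        (1 / r * ((r / 9) ^ (m + 1) * (volume : Measure E).real (ball 0 1))) := by
        push_cast; rw [div_pow]; field_simp; ring
    _ ≤ _ := by gcongr

lemma map_sphereMap_toSphere (g : E ≃ₗᵢ[ℝ] E) :
    (volume : Measure E).toSphere.map (sphereMap g) = (volume : Measure E).toSphere := by
  ext s hs
  have hm := (continuous_sphereMap g).measurable
  rw [Measure.map_apply hm hs, Measure.toSphere_apply' _ (hm hs), Measure.toSphere_apply' _ hs]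
  congr 1
  have : Ioo (0 : ℝ) 1 • ((↑) '' (sphereMap g ⁻¹' s) : Set E) =
      g.toHomeomorph.toMeasurableEquiv ⁻¹' (Ioo (0 : ℝ) 1 • ((↑) '' s)) := by
    ext x
    constructor
    · rintro ⟨t, ht, _, ⟨ω, hω, rfl⟩, rfl⟩
      exact ⟨t, ht, _, ⟨_, hω, rfl⟩, (g.map_smul t ω).symm⟩
    · rintro ⟨t, ht, _, ⟨ω, hω, rfl⟩, h⟩
      refine ⟨t, ht, _, ⟨sphereMap g.symm ω, ?_, rfl⟩, ?_⟩
      · have : sphereMap g (sphereMap g.symm ω) = ω := by ext; simp [sphereMap]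
        rwa [mem_preimage, this]
      · have h' : t • (ω : E) = g x := h
        show t • g.symm ω = x
        rw [← g.symm.map_smul, h', g.symm_apply_apply]
  rw [this]
  exact MeasurePreserving.measure_preimage_equiv
    (f := g.toHomeomorph.toMeasurableEquiv) g.measurePreserving _

lemma exists_isRegularSurface_sphere {m : ℕ} (hm : Module.finrank ℝ E = m + 1)
    {A : ℝ} {κ : ℝ → E → ℝ} (hκ : IsPieceFamily m A κ) (hA : 0 ≤ A) (c : E) {R : ℝ} (hR : 0 < R) :
    ∃ A' a, 0 ≤ A' ∧ 0 < a ∧ IsRegularSurface m κ (fun ω : sphere (0 : E) 1 => c + R • (ω : E))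
      (volume : Measure E).toSphere A' a R := by
  set V := (volume : Measure E).real (ball 0 1) with hVdef
  have hV : 0 < V := ENNReal.toReal_pos (measure_ball_pos _ _ one_pos).ne' measure_ball_lt_top.ne
  set σ := (volume : Measure E).toSphere with hσ
  set U := (m + 1) * 2 ^ (m + 2) * V * (2 / R) ^ m with hU
  have hU0 : 0 ≤ U := by positivity
  have hz : ∀ ω ω' : sphere (0 : E) 1,
      c + R • (ω : E) - (c + R • (ω' : E)) = R • ((ω : E) - ω') := fun ω ω' => by module
  have hzn : ∀ ω ω' : sphere (0 : E) 1,
      ‖c + R • (ω : E) - (c + R • (ω' : E))‖ = R * ‖(ω : E) - ω'‖ := fun ω ω' => by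
    rw [hz, norm_smul, Real.norm_of_nonneg hR.le]
  have hupper : ∀ (x : E) (r : ℝ), 0 < r →
      σ.real {ω | ‖c + R • (ω : E) - x‖ ≤ r} ≤ U * r ^ m := by
    intro x r hr
    rcases eq_empty_or_nonempty {ω : sphere (0 : E) 1 | ‖c + R • (ω : E) - x‖ ≤ r} with
      h | ⟨ω₀, hω₀⟩
    · rw [h, measureReal_empty]; positivity
    · calc _ ≤ σ.real {ω | ‖(ω : E) - ω₀‖ ≤ 2 * r / R} := by
            refine measureReal_mono fun ω hω => ?_
            rw [Set.mem_ofPred_eq, le_div_iff₀ hR, mul_comm, ← hzn]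
            calc _ = ‖(c + R • (ω : E) - x) - (c + R • (ω₀ : E) - x)‖ := by congr 1; abel
              _ ≤ ‖c + R • (ω : E) - x‖ + ‖c + R • (ω₀ : E) - x‖ := norm_sub_le _ _
              _ ≤ r + r := add_le_add hω hω₀
              _ = 2 * r := by ring
        _ ≤ _ := toSphere_near_le hm ω₀ (by positivity)
        _ = _ := by rw [hU, mul_div_right_comm, mul_pow]; ring
  refine ⟨U + 8 * A * U * 4 ^ m / R, (m + 1) * V / 9 ^ (m + 1) / R ^ m, by positivity,
    by positivity, ⟨fun x r hr => ?_, fun ω t ht htR => ?_, fun ω r hr => ?_⟩⟩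
  · refine (hupper x r hr).trans ?_
    gcongr
    exact le_add_of_nonneg_right (by positivity)
  · refine le_trans (le_of_eq ?_) ((le_toSphere_near hm ω (r := t / R) (by positivity)
      (by rw [div_le_iff₀ hR]; exact htR)).trans (measureReal_mono fun ω' hω' => ?_))
    · rw [div_pow]; ring
    · rw [Set.mem_ofPred_eq, hzn, mul_comm, ← le_div_iff₀ hR]; exact hω'
  · have hcont := hκ.continuous hA hr
    set φ := sphereMap (ℝ ∙ (ω : E)).reflection with hφ
    set F : sphere (0 : E) 1 → ℝ := fun ω' => κ r (c + R • (ω : E) - (c + R • (ω' : E))) with hF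
    have hFc : Continuous F := by fun_prop
    have hint : ∀ {G : sphere (0 : E) 1 → ℝ}, Continuous G → Integrable G σ := fun hG =>
      hG.integrable_of_hasCompactSupport (HasCompactSupport.of_compactSpace _)
    have hφc : Continuous φ := continuous_sphereMap _
    have hsym : ∫ ω', F (φ ω') ∂σ = ∫ ω', F ω' ∂σ := by
      conv_rhs => rw [hσ, ← map_sphereMap_toSphere (ℝ ∙ (ω : E)).reflection]
      rw [integral_map hφc.measurable.aemeasurable hFc.aestronglyMeasurable]
    have h2 : 2 * ∫ ω', F ω' ∂σ = ∫ ω', (F ω' + F (φ ω')) ∂σ := by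
      rw [integral_add (hint hFc) (hint (G := fun ω' => F (φ ω')) (hFc.comp hφc)), hsym]; ring
    have hb : |∫ ω', (F ω' + F (φ ω')) ∂σ| ≤
        16 * A * r ^ 2 / (R * r ^ (m + 1)) *
          σ.real {ω' | ‖c + R • (ω' : E) - (c + R • (ω : E))‖ ≤ 4 * r} := by
      refine abs_integral_le_of_support (by positivity) fun ω' hω' => ?_
      have hn : ‖c + R • (ω : E) - (c + R • (φ ω' : E))‖ =
          ‖c + R • (ω : E) - (c + R • (ω' : E))‖ := by
        rw [hzn, hzn, norm_sub_sphereMap_reflection]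
      have hle : ‖c + R • (ω : E) - (c + R • (ω' : E))‖ ≤ 4 * r := by
        by_contra! hlt
        refine hω' ?_
        have h1 : F ω' = 0 := by
          by_contra h; exact absurd (hκ.supp _ _ hr h).2 (not_le.2 hlt)
        have h2 : F (φ ω') = 0 := by
          by_contra h; exact absurd (hκ.supp _ _ hr h).2 (by rw [hn]; exact not_le.2 hlt)
        rw [h1, h2, add_zero]
      refine ⟨by rw [Set.mem_ofPred_eq, norm_sub_rev]; exact hle, ?_⟩
      have hodd : F ω' = - κ r (-(c + R • (ω : E) - (c + R • (ω' : E)))) := by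
        rw [hκ.odd, neg_neg]
      rw [hodd, neg_add_eq_sub]
      refine (hκ.lip _ _ _ hr).trans ?_
      have : c + R • (ω : E) - (c + R • (φ ω' : E)) - -(c + R • (ω : E) - (c + R • (ω' : E))) =
          (R * ‖(ω : E) - ω'‖ ^ 2) • (ω : E) := by
        rw [hz, hz, sub_sphereMap_reflection]; module
      rw [this, norm_smul, Real.norm_of_nonneg (by positivity), norm_eq_of_mem_sphere, mul_one]
      rw [hzn] at hle
      rw [div_le_div_iff₀ (by positivity) (by positivity)]
      have hsq : (R * ‖(ω : E) - ω'‖) ^ 2 ≤ (4 * r) ^ 2 := by gcongr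
      calc _ = A * (R * ‖(ω : E) - ω'‖) ^ 2 * r ^ (m + 1) := by ring
        _ ≤ A * (4 * r) ^ 2 * r ^ (m + 1) := by gcongr
        _ = _ := by ring
    have hfin : 16 * A * r ^ 2 / (R * r ^ (m + 1)) *
          σ.real {ω' | ‖c + R • (ω' : E) - (c + R • (ω : E))‖ ≤ 4 * r} ≤
        2 * (8 * A * U * 4 ^ m / R * r) := by
      calc _ ≤ 16 * A * r ^ 2 / (R * r ^ (m + 1)) * (U * (4 * r) ^ m) := by
            gcongr; exact hupper _ _ (by positivity)
        _ = _ := by rw [mul_pow]; field_simp; ring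
    have : |2 * ∫ ω', F ω' ∂σ| ≤ 2 * (8 * A * U * 4 ^ m / R * r) := by
      rw [h2]; exact hb.trans hfin
    rw [abs_mul, abs_two] at this
    calc _ ≤ 8 * A * U * 4 ^ m / R * r := by linarith
      _ ≤ _ := by gcongr; exact le_add_of_nonneg_left hU0

end SphereMeasure

/-! ### Integral operators with odd kernels on a regular surface -/

lemma IsPieceFamily.mono {E : Type*} [NormedAddCommGroup E] {m : ℕ} {A A' : ℝ} {κ : ℝ → E → ℝ}
    (h : IsPieceFamily m A κ) (hA : A ≤ A') : IsPieceFamily m A' κ where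
  odd := h.odd
  supp := h.supp
  bound r x hr := (h.bound r x hr).trans (by gcongr)
  lip r x y hr := (h.lip r x y hr).trans (by gcongr)

lemma IsRegularSurface.mono {E X : Type*} [NormedAddCommGroup E] [MeasurableSpace X]
    {m : ℕ} {κ : ℝ → E → ℝ} {z : X → E} {σ : Measure X} {A A' a R : ℝ}
    (h : IsRegularSurface m κ z σ A a R) (hA : A ≤ A') : IsRegularSurface m κ z σ A' a R where
  upper x r hr := (h.upper x r hr).trans (by gcongr)
  lower := h.lower
  cancel ω r hr := (h.cancel ω r hr).trans (by gcongr)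

section SurfaceOperators

lemma IsPieceFamily.continuous_kernel {X E : Type*} [TopologicalSpace X] [NormedAddCommGroup E]
    {m : ℕ} {A : ℝ} {κ : ℝ → E → ℝ} {z : X → E} (hκ : IsPieceFamily m A κ) (hz : Continuous z)
    (hA : 0 ≤ A) {r : ℝ} (hr : 0 < r) :
    Continuous (Function.uncurry fun ω ω' : X => κ r (z ω - z ω')) :=
  (hκ.continuous hA hr).comp ((hz.comp continuous_fst).sub (hz.comp continuous_snd))

variable {X : Type*} [MetricSpace X] [CompactSpace X] [MeasurableSpace X] {σ : Measure X}
  [IsFiniteMeasure σ]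

lemma norm_integralOperator_le {k : X → X → ℝ} {T : C(X, ℝ) →L[ℝ] C(X, ℝ)}
    (hT : ∀ f ω, T f ω = ∫ ω', k ω ω' * f ω' ∂σ) {s : X → Set X} {c M : ℝ} (hc : 0 ≤ c)
    (hM : 0 ≤ M) (hk : ∀ ω ω', k ω ω' ≠ 0 → ω' ∈ s ω ∧ |k ω ω'| ≤ c)
    (hs : ∀ ω, σ.real (s ω) ≤ M) : ‖T‖ ≤ c * M := by
  refine T.opNorm_le_bound (by positivity) fun f => ?_
  rw [ContinuousMap.norm_le _ (by positivity)]
  intro ω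
  rw [hT, Real.norm_eq_abs]
  calc _ ≤ c * ‖f‖ * σ.real (s ω) := by
        refine abs_integral_le_of_support (by positivity) fun ω' h => ?_
        have := hk ω ω' (left_ne_zero_of_mul h)
        refine ⟨this.1, ?_⟩
        rw [abs_mul]
        exact mul_le_mul this.2 (f.norm_coe_le_norm ω') (abs_nonneg _) hc
    _ ≤ c * ‖f‖ * M := by gcongr; exact hs ω
    _ = _ := by ring

variable [BorelSpace X]

lemma Continuous.integrable_of_compactSpace {f : X → ℝ} (hf : Continuous f) : Integrable f σ :=
  hf.integrable_of_hasCompactSupport (HasCompactSupport.of_compactSpace _)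

lemma integral_integral_swap_of_continuous {f : X → X → ℝ} (hf : Continuous (Function.uncurry f)) :
    ∫ x, ∫ y, f x y ∂σ ∂σ = ∫ y, ∫ x, f x y ∂σ ∂σ :=
  integral_integral_swap hf.integrable_of_compactSpace

lemma exists_integralOperator {k : X → X → ℝ} (hk : Continuous (Function.uncurry k)) :
    ∃ T : C(X, ℝ) →L[ℝ] C(X, ℝ), ∀ f ω, T f ω = ∫ ω', k ω ω' * f ω' ∂σ := by
  have hc : ∀ f : C(X, ℝ), Continuous (fun ω => ∫ ω', k ω ω' * f ω' ∂σ) := fun f => by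
    have h : Continuous (Function.uncurry fun ω ω' => k ω ω' * f ω') :=
      hk.mul (f.continuous.comp continuous_snd)
    simpa using continuous_parametric_integral_of_continuous (μ := σ) h isCompact_univ
  have hint : ∀ (f : C(X, ℝ)) ω, Integrable (fun ω' => k ω ω' * f ω') σ := fun f ω =>
    ((hk.comp (Continuous.prodMk_right ω)).mul f.continuous).integrable_of_compactSpace
  obtain ⟨M, hM⟩ := (isCompact_univ.image hk).isBounded.exists_norm_le
  have hM' : ∀ ω ω', |k ω ω'| ≤ M := fun ω ω' => hM _ ⟨(ω, ω'), mem_univ _, rfl⟩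
  let L : C(X, ℝ) →ₗ[ℝ] C(X, ℝ) :=
    { toFun := fun f => ⟨_, hc f⟩
      map_add' := fun f g => by
        ext ω
        simp only [ContinuousMap.coe_mk, ContinuousMap.add_apply, mul_add]
        exact integral_add (hint f ω) (hint g ω)
      map_smul' := fun c f => by
        ext ω
        simp only [ContinuousMap.coe_mk, ContinuousMap.smul_apply, smul_eq_mul, RingHom.id_apply,
          mul_left_comm _ c]
        exact integral_const_mul _ _ }
  refine ⟨L.mkContinuous (|M| * σ.real univ) fun f => ?_, fun f ω => rfl⟩
  rw [ContinuousMap.norm_le _ (by positivity)]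
  intro ω
  refine (abs_integral_le_of_support (c := |M| * ‖f‖) (s := univ) (by positivity)
    fun ω' _ => ⟨mem_univ _, ?_⟩).trans (le_of_eq (by ring))
  rw [abs_mul]
  exact mul_le_mul ((hM' ω ω').trans (le_abs_self M)) (f.norm_coe_le_norm ω') (abs_nonneg _)
    (abs_nonneg _)

lemma integralOperator_mul {k l : X → X → ℝ} (hk : Continuous (Function.uncurry k))
    (hl : Continuous (Function.uncurry l)) {T S : C(X, ℝ) →L[ℝ] C(X, ℝ)}
    (hT : ∀ f ω, T f ω = ∫ ω', k ω ω' * f ω' ∂σ) (hS : ∀ f ω, S f ω = ∫ ω', l ω ω' * f ω' ∂σ)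
    (f : C(X, ℝ)) (ω : X) :
    (T * S) f ω = ∫ ω'', (∫ ω', k ω ω' * l ω' ω'' ∂σ) * f ω'' ∂σ := by
  calc _ = ∫ ω', k ω ω' * ∫ ω'', l ω' ω'' * f ω'' ∂σ ∂σ := by
        rw [mul_apply_eq_comp, hT]; simp only [hS]
    _ = ∫ ω', ∫ ω'', k ω ω' * l ω' ω'' * f ω'' ∂σ ∂σ := by
        simp only [← integral_const_mul, mul_assoc]
    _ = ∫ ω'', ∫ ω', k ω ω' * l ω' ω'' * f ω'' ∂σ ∂σ := by
        refine integral_integral_swap_of_continuous ?_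
        have h1 : Continuous (fun p : X × X => k ω p.1) :=
          hk.comp (continuous_const.prodMk continuous_fst)
        exact (h1.mul hl).mul (f.continuous.comp continuous_snd)
    _ = _ := by simp only [integral_mul_const]

/-- The bilinear form of `L²(σ)` on continuous functions. -/
def integralForm (σ : Measure X) [IsFiniteMeasure σ] : C(X, ℝ) →ₗ[ℝ] C(X, ℝ) →ₗ[ℝ] ℝ :=
  LinearMap.mk₂ ℝ (fun f g => ∫ ω, f ω * g ω ∂σ)
    (fun f f' g => by
      simp only [ContinuousMap.add_apply, add_mul]
      exact integral_add (f.continuous.mul g.continuous).integrable_of_compactSpace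
        (f'.continuous.mul g.continuous).integrable_of_compactSpace)
    (fun c f g => by
      simp only [ContinuousMap.smul_apply, smul_eq_mul, mul_assoc]
      exact integral_const_mul _ _)
    (fun f g g' => by
      simp only [ContinuousMap.add_apply, mul_add]
      exact integral_add (f.continuous.mul g.continuous).integrable_of_compactSpace
        (f.continuous.mul g'.continuous).integrable_of_compactSpace)
    (fun c f g => by
      simp only [ContinuousMap.smul_apply, smul_eq_mul, mul_left_comm _ c]
      exact integral_const_mul _ _)

lemma integralForm_apply (f g : C(X, ℝ)) : integralForm σ f g = ∫ ω, f ω * g ω ∂σ := rfl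

lemma integralForm_integralOperator {k : X → X → ℝ} (hk : Continuous (Function.uncurry k))
    (hodd : ∀ ω ω', k ω ω' = -k ω' ω) {T : C(X, ℝ) →L[ℝ] C(X, ℝ)}
    (hT : ∀ f ω, T f ω = ∫ ω', k ω ω' * f ω' ∂σ) (f g : C(X, ℝ)) :
    integralForm σ (T f) g = -integralForm σ f (T g) := by
  rw [integralForm_apply, integralForm_apply]
  simp only [hT, ← integral_mul_const, ← integral_const_mul]
  rw [integral_integral_swap_of_continuous, ← integral_neg]
  · refine integral_congr_ae (Eventually.of_forall fun ω => ?_)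
    show _ = - _
    rw [← integral_neg]
    refine integral_congr_ae (Eventually.of_forall fun ω' => ?_)
    show _ = - _
    simp only [hodd ω' ω]; ring
  · exact (hk.mul (f.continuous.comp continuous_snd)).mul (g.continuous.comp continuous_fst)

variable {E : Type*} [NormedAddCommGroup E] {m : ℕ} {A a R : ℝ} {κ : ℝ → E → ℝ} {z : X → E}

lemma abs_integral_kernel_mul_le (hκ : IsPieceFamily m A κ) (hz : Continuous z)
    (hσ : IsRegularSurface m κ z σ A a R) (hA : 0 ≤ A) {s : ℝ} (hs : 0 < s) {p : X → ℝ}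
    (hp : Continuous p) {ω : X} {L M : ℝ} (hL0 : 0 ≤ L)
    (hL : ∀ ω', |p ω' - p ω| ≤ L * ‖z ω' - z ω‖) (hM : |p ω| ≤ M) :
    |∫ ω', κ s (z ω - z ω') * p ω' ∂σ| ≤ (4 ^ (m + 1) * A ^ 2 * L + A * M) * s := by
  have hc : Continuous fun ω' => κ s (z ω - z ω') :=
    (hκ.continuous hA hs).comp (continuous_const.sub hz)
  have h1 : ∫ ω', κ s (z ω - z ω') * p ω' ∂σ =
      ∫ ω', κ s (z ω - z ω') * (p ω' - p ω) ∂σ + (∫ ω', κ s (z ω - z ω') ∂σ) * p ω := by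
    rw [← integral_mul_const, ← integral_add]
    · congr 1; ext ω'; ring
    · exact (hc.mul (hp.sub continuous_const)).integrable_of_compactSpace
    · exact (hc.mul continuous_const).integrable_of_compactSpace
  have h2 : |∫ ω', κ s (z ω - z ω') * (p ω' - p ω) ∂σ| ≤
      A / s ^ m * (L * (4 * s)) * σ.real {ω' | ‖z ω' - z ω‖ ≤ 4 * s} := by
    refine abs_integral_le_of_support (by positivity) fun ω' h => ?_
    have h4 : ‖z ω' - z ω‖ ≤ 4 * s := by
      rw [norm_sub_rev]; exact (hκ.supp _ _ hs (left_ne_zero_of_mul h)).2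
    refine ⟨h4, ?_⟩
    rw [abs_mul]
    exact mul_le_mul (hκ.bound _ _ hs) ((hL ω').trans (by gcongr)) (abs_nonneg _) (by positivity)
  rw [h1]
  refine (abs_add_le _ _).trans ?_
  rw [abs_mul, add_mul]
  refine add_le_add ?_ ?_
  · calc _ ≤ A / s ^ m * (L * (4 * s)) * (A * (4 * s) ^ m) :=
          h2.trans (by gcongr; exact hσ.upper _ _ (by positivity))
      _ = _ := by rw [mul_pow]; field_simp; ring
  · calc _ ≤ (A * s) * M := mul_le_mul (hσ.cancel _ _ hs) hM (abs_nonneg _) (by positivity)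
      _ = _ := by ring

lemma IsPieceFamily.kernel_symm (hκ : IsPieceFamily m A κ) (r : ℝ) (x y : E) :
    κ r (x - y) = -κ r (y - x) := by rw [← hκ.odd, neg_sub]

lemma abs_integral_kernel_mul_kernel_le (hκ : IsPieceFamily m A κ) (hz : Continuous z)
    (hσ : IsRegularSurface m κ z σ A a R) (hA : 0 ≤ A) {r s : ℝ} (hr : 0 < r) (hs : 0 < s)
    (ω ω'' : X) :
    |∫ ω', κ s (z ω - z ω') * κ r (z ω' - z ω'') ∂σ| ≤
      (4 ^ (m + 1) * A ^ 3 + A ^ 2) * (s / r + s) / r ^ m := by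
  refine (abs_integral_kernel_mul_le hκ hz hσ hA hs (p := fun ω' => κ r (z ω' - z ω''))
    (L := A / r ^ (m + 1)) ((hκ.continuous hA hr).comp (hz.sub continuous_const)) (by positivity)
    (fun ω' => ?_) (hκ.bound _ _ hr)).trans ?_
  · refine (hκ.lip _ _ _ hr).trans (le_of_eq ?_)
    rw [sub_sub_sub_cancel_right]; ring
  · calc _ = (4 ^ (m + 1) * A ^ 3 * (s / r) + A ^ 2 * s) / r ^ m := by field_simp; ring
      _ ≤ _ := by
        rw [add_mul]
        gcongr
        · exact le_add_of_nonneg_right hs.le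
        · exact le_add_of_nonneg_left (by positivity)

lemma norm_pieceOperator_mul_le (hκ : IsPieceFamily m A κ) (hz : Continuous z)
    (hσ : IsRegularSurface m κ z σ A a R) (hA : 0 ≤ A) {r s : ℝ} (hs : 0 < s) (hsr : s ≤ r)
    {T S : C(X, ℝ) →L[ℝ] C(X, ℝ)} (hT : ∀ f ω, T f ω = ∫ ω', κ r (z ω - z ω') * f ω' ∂σ)
    (hS : ∀ f ω, S f ω = ∫ ω', κ s (z ω - z ω') * f ω' ∂σ) :
    ‖T * S‖ ≤ (4 ^ (m + 1) * A ^ 3 + A ^ 2) * A * 8 ^ m * (s / r + s) ∧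
    ‖S * T‖ ≤ (4 ^ (m + 1) * A ^ 3 + A ^ 2) * A * 8 ^ m * (s / r + s) := by
  have hr : 0 < r := hs.trans_le hsr
  have key : ∀ ω ω'' : X, (∫ ω', κ s (z ω - z ω') * κ r (z ω' - z ω'') ∂σ) ≠ 0 →
      ‖z ω'' - z ω‖ ≤ 8 * r := by
    intro ω ω'' h
    by_contra! hlt
    refine h (integral_eq_zero_of_ae (Eventually.of_forall fun ω' => ?_))
    show _ = (0 : ℝ)
    by_contra h0
    have h1 := (hκ.supp _ _ hs (left_ne_zero_of_mul h0)).2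
    have h2 := (hκ.supp _ _ hr (right_ne_zero_of_mul h0)).2
    have h3 := norm_add_le (z ω - z ω') (z ω' - z ω'')
    rw [sub_add_sub_cancel, norm_sub_rev] at h3
    linarith
  have hsymm : ∀ ω ω'' : X, ∫ ω', κ r (z ω - z ω') * κ s (z ω' - z ω'') ∂σ =
      ∫ ω', κ s (z ω'' - z ω') * κ r (z ω' - z ω) ∂σ := fun ω ω'' => by
    congr 1; ext ω'
    rw [hκ.kernel_symm r (z ω), hκ.kernel_symm s (z ω')]; ring
  have hmul : (4 ^ (m + 1) * A ^ 3 + A ^ 2) * (s / r + s) / r ^ m * (A * (8 * r) ^ m) =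
      (4 ^ (m + 1) * A ^ 3 + A ^ 2) * A * 8 ^ m * (s / r + s) := by
    rw [mul_pow]; field_simp
  have hk := fun {r : ℝ} (hr : 0 < r) => hκ.continuous_kernel hz hA hr
  constructor
  · rw [← hmul]
    refine norm_integralOperator_le (integralOperator_mul (hk hr) (hk hs) hT hS)
      (s := fun ω => {ω' | ‖z ω' - z ω‖ ≤ 8 * r}) (by positivity) (by positivity)
      (fun ω ω'' h => ?_) fun ω => hσ.upper _ _ (by positivity)
    simp only [hsymm] at h ⊢
    refine ⟨?_, abs_integral_kernel_mul_kernel_le hκ hz hσ hA hr hs _ _⟩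
    have := key _ _ h
    rwa [norm_sub_rev] at this
  · rw [← hmul]
    exact norm_integralOperator_le (integralOperator_mul (hk hs) (hk hr) hS hT)
      (s := fun ω => {ω' | ‖z ω' - z ω‖ ≤ 8 * r}) (by positivity) (by positivity)
      (fun ω ω'' h => ⟨key _ _ h, abs_integral_kernel_mul_kernel_le hκ hz hσ hA hr hs _ _⟩)
      fun ω => hσ.upper _ _ (by positivity)

lemma norm_pieceOperator_le (hκ : IsPieceFamily m A κ)
    (hσ : IsRegularSurface m κ z σ A a R) (hA : 0 ≤ A) {r : ℝ} (hr : 0 < r)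
    {T : C(X, ℝ) →L[ℝ] C(X, ℝ)} (hT : ∀ f ω, T f ω = ∫ ω', κ r (z ω - z ω') * f ω' ∂σ) :
    ‖T‖ ≤ 4 ^ m * A ^ 2 := by
  calc _ ≤ A / r ^ m * (A * (4 * r) ^ m) := by
        refine norm_integralOperator_le hT (s := fun ω => {ω' | ‖z ω' - z ω‖ ≤ 4 * r})
          (by positivity) (by positivity) (fun ω ω' h => ⟨?_, hκ.bound _ _ hr⟩)
          fun ω => hσ.upper _ _ (by positivity)
        show ‖_‖ ≤ _
        rw [norm_sub_rev]; exact (hκ.supp _ _ hr h).2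
    _ = _ := by rw [mul_pow]; field_simp

lemma sum_geometric_sub_le {N : ℕ} : ∑ j ∈ Finset.range N, (3 / 4 : ℝ) ^ (N - j) ≤ 4 := by
  suffices h : ∑ j ∈ Finset.range N, (3 / 4 : ℝ) ^ (N - j) = 3 - 3 * (3 / 4) ^ N by
    rw [h]; linarith [pow_pos (by norm_num : (0 : ℝ) < 3 / 4) N]
  induction N with
  | zero => simp
  | succ N ih =>
    rw [Finset.sum_range_succ, Nat.add_sub_cancel_left]
    have : ∀ j ∈ Finset.range N, (3 / 4 : ℝ) ^ (N + 1 - j) = 3 / 4 * (3 / 4) ^ (N - j) := by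
      intro j hj
      rw [Nat.sub_add_comm (Finset.mem_range.1 hj).le, pow_succ']
    rw [Finset.sum_congr rfl this, ← Finset.mul_sum, ih]
    ring

lemma sum_geometric_dist_le (N i : ℕ) :
    ∑ j ∈ Finset.range N, (3 / 4 : ℝ) ^ (max i j - min i j) ≤ 8 := by
  have h1 : ∑ j ∈ Finset.range N with j < i, (3 / 4 : ℝ) ^ (max i j - min i j) ≤ 4 := by
    refine le_trans ?_ (sum_geometric_sub_le (N := i))
    calc _ = ∑ j ∈ Finset.range N with j < i, (3 / 4 : ℝ) ^ (i - j) :=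
          Finset.sum_congr rfl fun j hj => by
            rw [max_eq_left (Finset.mem_filter.1 hj).2.le,
              min_eq_right (Finset.mem_filter.1 hj).2.le]
      _ ≤ _ := by
          refine Finset.sum_le_sum_of_subset_of_nonneg (fun j hj => ?_) fun _ _ _ => by positivity
          simpa using (Finset.mem_filter.1 hj).2
  have h2 : ∑ j ∈ Finset.range N with ¬ j < i, (3 / 4 : ℝ) ^ (max i j - min i j) ≤ 4 := by
    calc _ = ∑ j ∈ Finset.range N with ¬ j < i, (3 / 4 : ℝ) ^ (j - i) :=
          Finset.sum_congr rfl fun j hj => by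
            have := not_lt.1 (Finset.mem_filter.1 hj).2
            rw [max_eq_right this, min_eq_left this]
      _ = ∑ k ∈ (Finset.range N |>.filter (¬ · < i)).image (· - i), (3 / 4 : ℝ) ^ k := by
          rw [Finset.sum_image]
          intro x hx y hy hxy
          simp at hx hy hxy
          omega
      _ ≤ ∑' k, (3 / 4 : ℝ) ^ k :=
          (summable_geometric_of_lt_one (by norm_num) (by norm_num)).sum_le_tsum _
            fun _ _ => by positivity
      _ = 4 := by rw [tsum_geometric_of_lt_one (by norm_num) (by norm_num)]; norm_num
  rw [← Finset.sum_filter_add_sum_filter_not _ (· < i)]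
  linarith

/-- `L²(σ)`-boundedness of the singular integral on the surface, uniformly in the number of
pieces, in the form of a bilinear estimate. -/
theorem exists_sq_integral_sum_piece_le (hκ : IsPieceFamily m A κ) (hz : Continuous z)
    (hσ : IsRegularSurface m κ z σ A a R) (hA : 0 ≤ A) {ρ : ℝ} (hρ : 0 ≤ ρ) :
    ∃ Λ, 0 ≤ Λ ∧ ∀ ε N, 0 < ε → ε * 2 ^ N ≤ ρ → ∀ f g : C(X, ℝ),
      (∑ j ∈ Finset.range N,
        ∫ ω, (∫ ω', κ (ε * 2 ^ j) (z ω - z ω') * f ω' ∂σ) * g ω ∂σ) ^ 2 ≤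
      Λ * (∫ ω, f ω * f ω ∂σ) * ∫ ω, g ω * g ω ∂σ := by
  set C := (4 ^ (m + 1) * A ^ 3 + A ^ 2) * A * 8 ^ m with hC
  have hC0 : 0 ≤ C := by positivity
  set b := C * (1 + ρ) + 1 with hb
  have hb1 : 1 ≤ b := le_add_of_nonneg_left (by positivity)
  refine ⟨(12 * b) ^ 2, by positivity, fun ε N hε hN f g => ?_⟩
  have hr : ∀ j : ℕ, 0 < ε * 2 ^ j := fun j => by positivity
  choose T hT using fun j : ℕ =>
    exists_integralOperator (σ := σ) (hκ.continuous_kernel hz hA (hr j))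
  have hpow : ∀ k : ℕ, ((1 / 2 : ℝ)) ^ k ≤ ((3 / 4) ^ k) ^ 2 := fun k => by
    rw [← pow_mul, mul_comm, pow_mul]; gcongr; norm_num
  set γ : ℕ → ℕ → ℝ := fun i j => b * ((3 / 4) ^ (max i j - min i j) + (3 / 4) ^ (N - j)) with hγ
  have hTT : ∀ i j, i < N → j < N → ‖T i * T j‖ ≤ γ i j ^ 2 := by
    intro i j hi hj
    have h1 : ‖T i * T j‖ ≤ C * (ε * 2 ^ min i j / (ε * 2 ^ max i j) + ε * 2 ^ min i j) := by
      rcases le_total i j with h | h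
      · rw [min_eq_left h, max_eq_right h]
        exact (norm_pieceOperator_mul_le hκ hz hσ hA (hr i) (by gcongr; norm_num)
          (hT j) (hT i)).2
      · rw [min_eq_right h, max_eq_left h]
        exact (norm_pieceOperator_mul_le hκ hz hσ hA (hr j) (by gcongr; norm_num)
          (hT i) (hT j)).1
    have h2 : ε * 2 ^ min i j / (ε * 2 ^ max i j) = (1 / 2 : ℝ) ^ (max i j - min i j) := by
      obtain ⟨d, hd⟩ := Nat.exists_eq_add_of_le (min_le_max : min i j ≤ max i j)
      rw [hd, Nat.add_sub_cancel_left, pow_add, one_div, inv_pow]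
      field_simp
    have h3 : ε * 2 ^ min i j ≤ ρ * (1 / 2 : ℝ) ^ (N - j) := by
      calc _ ≤ ε * 2 ^ j := by gcongr; · norm_num
                               · exact min_le_right _ _
        _ = ε * 2 ^ N * (1 / 2 : ℝ) ^ (N - j) := by
          obtain ⟨d, rfl⟩ := Nat.exists_eq_add_of_le hj.le
          rw [Nat.add_sub_cancel_left, pow_add, one_div, inv_pow]
          field_simp
        _ ≤ _ := by gcongr
    have h4 := hpow (max i j - min i j)
    have h5 := hpow (N - j)
    rw [h2] at h1
    refine h1.trans ?_
    simp only [hγ]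
    set u := (3 / 4 : ℝ) ^ (max i j - min i j)
    set v := (3 / 4 : ℝ) ^ (N - j)
    have hu : 0 < u := by positivity
    have hv : 0 < v := by positivity
    calc _ ≤ C * (u ^ 2 + ρ * v ^ 2) := by
          refine mul_le_mul_of_nonneg_left (add_le_add h4 (h3.trans ?_)) hC0
          exact mul_le_mul_of_nonneg_left h5 hρ
      _ ≤ C * ((1 + ρ) * (u + v) ^ 2) := by
          gcongr
          nlinarith [mul_pos hu hv, mul_nonneg hρ (mul_pos hu hv).le, sq_nonneg u,
            mul_nonneg hρ (sq_nonneg u), sq_nonneg v]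
      _ ≤ b * (u + v) ^ 2 := by rw [← mul_assoc]; gcongr; linarith
      _ ≤ b ^ 2 * (u + v) ^ 2 := by gcongr; nlinarith
      _ = _ := by ring
  have hΛ : ∀ i, ∑ j : Fin N, γ i j ≤ 12 * b := fun i => by
    rw [Fin.sum_univ_eq_sum_range (γ i) N]
    simp only [hγ, ← Finset.mul_sum, Finset.sum_add_distrib]
    have := sum_geometric_dist_le N i
    have := sum_geometric_sub_le (N := N)
    nlinarith
  set S := ∑ j : Fin N, T j with hS
  have hskew : ∀ f g, integralForm σ (S f) g = -integralForm σ f (S g) := fun f g => by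
    simp only [hS, sum_apply, map_sum, LinearMap.sum_apply,
      ← Finset.sum_neg_distrib]
    exact Finset.sum_congr rfl fun j _ => integralForm_integralOperator
      (hκ.continuous_kernel hz hA (hr j)) (fun ω ω' => hκ.kernel_symm _ _ _) (hT j) f g
  have hB0 : ∀ f : C(X, ℝ), 0 ≤ integralForm σ f f := fun f =>
    integral_nonneg fun ω => mul_self_nonneg _
  have hBs : ∀ f g : C(X, ℝ), integralForm σ f g = integralForm σ g f := fun f g => by
    simp only [integralForm_apply, mul_comm]
  have hM : ∀ f : C(X, ℝ), integralForm σ f f ≤ σ.real univ * ‖f‖ ^ 2 := fun f => by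
    refine (le_abs_self _).trans ((abs_integral_le_of_support (c := ‖f‖ ^ 2) (s := univ)
      (by positivity) fun ω _ => ⟨mem_univ _, ?_⟩).trans (le_of_eq (mul_comm _ _)))
    rw [abs_mul, sq]
    exact mul_le_mul (f.norm_coe_le_norm ω) (f.norm_coe_le_norm ω) (abs_nonneg _) (norm_nonneg _)
  have hSS := skew_form_le (integralForm σ) hB0 hBs hM S hskew (by positivity : 0 < 12 * b)
    measureReal_nonneg (norm_sum_pow_succ_le (T := fun j : Fin N => T j)
      (γ := fun i j : Fin N => γ i j) (by positivity) (fun i j => by positivity)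
      (fun j => norm_pieceOperator_le hκ hσ hA (hr j) (hT j))
      (fun i j => hTT i j i.2 j.2) (fun i => hΛ i) (by positivity)) f
  have hcs := LinearMap.BilinForm.apply_mul_apply_le_of_forall_zero_le (integralForm σ) hB0 (S f) g
  rw [hBs g, ← sq] at hcs
  have hsum : ∑ j ∈ Finset.range N,
      ∫ ω, (∫ ω', κ (ε * 2 ^ j) (z ω - z ω') * f ω' ∂σ) * g ω ∂σ = integralForm σ (S f) g := by
    rw [← Fin.sum_univ_eq_sum_range
      (fun j => ∫ ω, (∫ ω', κ (ε * 2 ^ j) (z ω - z ω') * f ω' ∂σ) * g ω ∂σ)]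
    simp only [hS, sum_apply, map_sum, LinearMap.sum_apply,
      integralForm_apply, hT]
  rw [hsum]
  calc _ ≤ integralForm σ (S f) (S f) * integralForm σ g g := hcs
    _ ≤ (12 * b) ^ 2 * integralForm σ f f * integralForm σ g g := by
        gcongr
        exact hB0 g

end SurfaceOperators

/-! ### Smoothing measures onto a regular surface -/

section Smoothing

/-- Probability densities `p y` on the surface (for `y ∈ D`) concentrated at distance `≲ t y`
from `y`. -/
structure IsBumpFamily {E X : Type*} [NormedAddCommGroup E] [MeasurableSpace E]
    [TopologicalSpace X] [MeasurableSpace X] (m : ℕ) (z : X → E) (σ : Measure X) (t : E → ℝ)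
    (D : Set E) (B : ℝ) (p : E → X → ℝ) : Prop where
  measurable : Measurable (Function.uncurry p)
  continuous : ∀ y, Continuous (p y)
  nonneg : ∀ y ω, 0 ≤ p y ω
  le : ∀ y ω, p y ω ≤ B / t y ^ m
  lip : ∀ y ω ω', |p y ω - p y ω'| ≤ B / t y ^ (m + 1) * ‖z ω - z ω'‖
  supp : ∀ y ω, p y ω ≠ 0 → ‖z ω - y‖ ≤ 4 * t y
  integral_eq : ∀ y ∈ D, ∫ ω, p y ω ∂σ = 1
  integral_le : ∀ y, ∫ ω, p y ω ∂σ ≤ 1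

variable {X : Type*} [MetricSpace X] [CompactSpace X] [MeasurableSpace X] [BorelSpace X]
  {σ : Measure X} [IsFiniteMeasure σ]
  {E : Type*} [NormedAddCommGroup E] [MeasurableSpace E] {m : ℕ} {A a R : ℝ} {κ : ℝ → E → ℝ}
  {z : X → E}

lemma IsBumpFamily.integrable {t : E → ℝ} {D : Set E} {B : ℝ} {p : E → X → ℝ}
    (hp : IsBumpFamily m z σ t D B p) (y : E) : Integrable (p y) σ :=
  (hp.continuous y).integrable_of_compactSpace

lemma exists_isBumpFamily [BorelSpace E] (hz : Continuous z)
    (hσ : IsRegularSurface m κ z σ A a R) (ha : 0 < a)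
    {t : E → ℝ} (ht : Continuous t) (ht0 : ∀ y, 0 < t y) {D : Set E} (hD : MeasurableSet D)
    (hDt : ∀ y ∈ D, t y ≤ 2 * R ∧ ∃ ω, ‖z ω - y‖ ≤ t y) :
    ∃ p, IsBumpFamily m z σ t D (2 / a) p := by
  classical
  set b : E → X → ℝ := fun y ω => max 0 (1 - ‖z ω - y‖ / (4 * t y)) with hb
  have hbc : Continuous (Function.uncurry b) := by
    refine continuous_const.max (continuous_const.sub (Continuous.div ?_ ?_ fun y => ?_))
    · exact ((hz.comp continuous_snd).sub continuous_fst).norm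
    · exact continuous_const.mul (ht.comp continuous_fst)
    · exact (mul_pos (by norm_num) (ht0 _)).ne'
  have hbc' : ∀ y, Continuous (b y) := fun y => hbc.comp (Continuous.prodMk_right y)
  have hb0 : ∀ y ω, 0 ≤ b y ω := fun y ω => le_max_left _ _
  have hb1 : ∀ y ω, b y ω ≤ 1 := fun y ω =>
    max_le zero_le_one (sub_le_self _ (by have := ht0 y; positivity))
  have hblip : ∀ y ω ω', |b y ω - b y ω'| ≤ ‖z ω - z ω'‖ / t y := fun y ω ω' => by
    have := ht0 y
    refine (abs_max_sub_max_le_max _ _ _ _).trans (max_le (by rw [sub_self, abs_zero]; positivity)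
      ?_)
    rw [show 1 - ‖z ω - y‖ / (4 * t y) - (1 - ‖z ω' - y‖ / (4 * t y)) =
      (‖z ω' - y‖ - ‖z ω - y‖) / (4 * t y) by ring, abs_div,
      abs_of_pos (by positivity : 0 < 4 * t y)]
    have h := abs_norm_sub_norm_le (z ω' - y) (z ω - y)
    rw [sub_sub_sub_cancel_right, norm_sub_rev (z ω') (z ω)] at h
    exact div_le_div₀ (norm_nonneg _) h this (by linarith)
  set Z : E → ℝ := fun y => ∫ ω, b y ω ∂σ with hZ
  have hZm : Measurable Z := hbc.measurable.stronglyMeasurable.integral_prod_right.measurable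
  have hZ0 : ∀ y, 0 ≤ Z y := fun y => integral_nonneg (hb0 y)
  have hZl : ∀ y ∈ D, a / 2 * t y ^ m ≤ Z y := by
    intro y hy
    obtain ⟨h2R, ω₀, hω₀⟩ := hDt y hy
    have h1 := hσ.lower ω₀ (t y) (ht0 y) h2R
    set s := {ω' | ‖z ω' - z ω₀‖ ≤ t y} with hs
    have hsm : MeasurableSet s :=
      (isClosed_le (hz.sub continuous_const).norm continuous_const).measurableSet
    calc _ = 1 / 2 * (a * t y ^ m) := by ring
      _ ≤ 1 / 2 * σ.real s := by gcongr
      _ = ∫ ω, s.indicator (fun _ => (1 / 2 : ℝ)) ω ∂σ := by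
          rw [integral_indicator_const _ hsm, smul_eq_mul, mul_comm]
      _ ≤ Z y := by
          refine integral_mono ((integrable_const _).indicator hsm)
            (hbc' y).integrable_of_compactSpace fun ω => ?_
          by_cases hω : ω ∈ s
          · rw [indicator_of_mem hω]
            refine le_trans ?_ (le_max_right _ _)
            have h3 : ‖z ω - y‖ ≤ 2 * t y := by
              have := norm_add_le (z ω - z ω₀) (z ω₀ - y)
              rw [sub_add_sub_cancel] at this
              have h4 : ‖z ω - z ω₀‖ ≤ t y := hω
              linarith
            have : ‖z ω - y‖ / (4 * t y) ≤ 1 / 2 := by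
              rw [div_le_iff₀ (by have := ht0 y; positivity)]; linarith
            linarith
          · rw [indicator_of_notMem hω]; exact hb0 y ω
  have hinv : ∀ y ∈ D, 1 / Z y ≤ 2 / a / t y ^ m := fun y hy => by
    have := ht0 y
    calc 1 / Z y ≤ 1 / (a / 2 * t y ^ m) := by gcongr; exact hZl y hy
      _ = _ := by field_simp
  refine ⟨fun y ω => if y ∈ D then b y ω / Z y else 0, ?_, fun y => ?_, fun y ω => ?_,
    fun y ω => ?_,
    fun y ω ω' => ?_, fun y ω h => ?_, fun y hy => ?_, fun y => ?_⟩
  · exact Measurable.ite (measurable_fst hD) (hbc.measurable.div (hZm.comp measurable_fst))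
      measurable_const
  · by_cases hy : y ∈ D
    · simpa [hy] using (hbc' y).div_const _
    · simpa [hy] using continuous_const
  · split_ifs
    · exact div_nonneg (hb0 _ _) (hZ0 _)
    · rfl
  · have := ht0 y
    split_ifs with hy
    · refine le_trans ?_ (hinv y hy)
      exact div_le_div_of_nonneg_right (hb1 _ _) (hZ0 _)
    · positivity
  · have := ht0 y
    split_ifs with hy
    · rw [← sub_div, abs_div, abs_of_nonneg (hZ0 y)]
      calc _ = |b y ω - b y ω'| * (1 / Z y) := by ring
        _ ≤ ‖z ω - z ω'‖ / t y * (2 / a / t y ^ m) :=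
          mul_le_mul (hblip _ _ _) (hinv y hy) (by have := hZ0 y; positivity) (by positivity)
        _ = _ := by field_simp; ring
    · rw [sub_self, abs_zero]; positivity
  · have := ht0 y
    split_ifs at h with hy
    · by_contra! hlt
      refine h ?_
      have h1 : b y ω = 0 := max_eq_left (by
        rw [sub_nonpos, one_le_div (by positivity)]; exact hlt.le)
      rw [h1, zero_div]
    · exact absurd rfl h
  · simp only [if_pos hy]
    rw [integral_div]
    exact div_self ((by have := ht0 y; positivity : 0 < a / 2 * t y ^ m).trans_le (hZl y hy)).ne'
  · by_cases hy : y ∈ D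
    · simp only [if_pos hy]
      rw [integral_div]
      exact div_self_le_one _
    · simp [hy]

end Smoothing

section Fubini

variable {X Y : Type*} [MeasurableSpace X] [MeasurableSpace Y] {σ : Measure X}
  [IsFiniteMeasure σ] {ν ν' : Measure Y} [IsFiniteMeasure ν] [IsFiniteMeasure ν']

lemma Measurable.integrable_of_abs_le {f : X → ℝ} (hf : Measurable f) {C : ℝ}
    (hC : ∀ x, |f x| ≤ C) : Integrable f σ :=
  Integrable.of_bound hf.aestronglyMeasurable C (Eventually.of_forall hC)

lemma integral_integral_swap_of_abs_le {f : X → Y → ℝ} (hf : Measurable (Function.uncurry f))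
    {C : ℝ} (hC : ∀ x y, |f x y| ≤ C) :
    ∫ x, ∫ y, f x y ∂ν ∂σ = ∫ y, ∫ x, f x y ∂σ ∂ν :=
  integral_integral_swap (hf.integrable_of_abs_le fun p => hC p.1 p.2)

lemma measurable_integral_right {f : X → Y → ℝ} (hf : Measurable (Function.uncurry f)) :
    Measurable fun x => ∫ y, f x y ∂ν :=
  hf.stronglyMeasurable.integral_prod_right.measurable

lemma abs_integral_le_mul_real_univ {f : X → ℝ} {C : ℝ} (hC0 : 0 ≤ C) (hC : ∀ x, |f x| ≤ C) :
    |∫ x, f x ∂σ| ≤ C * σ.real univ :=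
  abs_integral_le_of_support hC0 fun x _ => ⟨mem_univ x, hC x⟩

/-- The pairing of two superpositions is the superposition of the pairings. -/
lemma integral_integral_mul_integral {f g : Y → X → ℝ} (hf : Measurable (Function.uncurry f))
    (hg : Measurable (Function.uncurry g)) {C C' : ℝ} (hC : ∀ y x, |f y x| ≤ C)
    (hC' : ∀ y x, |g y x| ≤ C') :
    ∫ x, (∫ y, f y x ∂ν) * (∫ y', g y' x ∂ν') ∂σ =
      ∫ y', ∫ y, ∫ x, f y x * g y' x ∂σ ∂ν ∂ν' := by
  have hC0 : ∀ y x, |f y x| ≤ |C| := fun y x => (hC y x).trans (le_abs_self C)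
  have hfm : Measurable fun x => ∫ y, f y x ∂ν :=
    measurable_integral_right (f := fun x y => f y x) (hf.comp measurable_swap)
  calc _ = ∫ x, ∫ y', (∫ y, f y x ∂ν) * g y' x ∂ν' ∂σ := by simp only [integral_const_mul]
    _ = ∫ y', ∫ x, (∫ y, f y x ∂ν) * g y' x ∂σ ∂ν' := by
        refine integral_integral_swap_of_abs_le (C := |C| * ν.real univ * C')
          ((hfm.comp measurable_fst).mul (hg.comp measurable_swap)) fun x y' => ?_
        rw [abs_mul]
        exact mul_le_mul (abs_integral_le_mul_real_univ (abs_nonneg C) fun y => hC0 y x) (hC' _ _)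
          (abs_nonneg _) (by positivity)
    _ = ∫ y', ∫ x, ∫ y, f y x * g y' x ∂ν ∂σ ∂ν' := by simp only [integral_mul_const]
    _ = _ := by
        congr 1; ext y'
        refine integral_integral_swap_of_abs_le (C := |C| * C')
          ((hf.comp measurable_swap).mul
            ((hg.comp (measurable_const.prodMk measurable_id)).comp measurable_fst)) fun x y => ?_
        rw [abs_mul]
        exact mul_le_mul (hC0 _ _) (hC' _ _) (abs_nonneg _) (abs_nonneg _)

end Fubini

section BumpFamily

variable {X E : Type*} [NormedAddCommGroup E] [MeasurableSpace E] [TopologicalSpace X]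
  [MeasurableSpace X] {m : ℕ} {B : ℝ} {z : X → E} {σ : Measure X}
  {t : E → ℝ} {D : Set E} {p : E → X → ℝ}

lemma IsBumpFamily.abs_le (hp : IsBumpFamily m z σ t D B p) (hB : 0 ≤ B)
    {ε : ℝ} (hε : 0 < ε) (ht : ∀ y, ε ≤ t y) (y : E) (ω : X) : |p y ω| ≤ B / ε ^ m := by
  rw [abs_of_nonneg (hp.nonneg y ω)]
  refine (hp.le y ω).trans ?_
  gcongr
  exact ht y

lemma IsBumpFamily.continuous_integral [FirstCountableTopology X] {ν : Measure E}
    [IsFiniteMeasure ν] (hp : IsBumpFamily m z σ t D B p) (hB : 0 ≤ B) {ε : ℝ} (hε : 0 < ε)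
    (ht : ∀ y, ε ≤ t y) : Continuous fun ω => ∫ y, p y ω ∂ν :=
  continuous_of_dominated (bound := fun _ => B / ε ^ m)
    (fun _ => (hp.measurable.comp measurable_prodMk_right).aestronglyMeasurable)
    (fun ω => Eventually.of_forall fun y => hp.abs_le hB hε ht y ω) (integrable_const _)
    (Eventually.of_forall hp.continuous)

end BumpFamily

section Superposition

variable {X : Type*} [MetricSpace X] [CompactSpace X] [MeasurableSpace X] [BorelSpace X]
  {σ : Measure X} [IsFiniteMeasure σ]
  {E : Type*} [NormedAddCommGroup E] [MeasurableSpace E]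
  {m : ℕ} {A a R B : ℝ} {κ : ℝ → E → ℝ} {z : X → E} {t : E → ℝ} {D : Set E} {p : E → X → ℝ}
  {ν ν' : Measure E} [IsFiniteMeasure ν] [IsFiniteMeasure ν']

/-- Smoothing at scale `t` a measure of dimension `m` gives a density in `L²`. -/
lemma IsBumpFamily.integral_sq_le [BorelSpace E] [SecondCountableTopology E]
    (hp : IsBumpFamily m z σ t D B p) (hB : 0 ≤ B) {ε : ℝ} (hε : 0 < ε)
    (ht : ∀ y, ε ≤ t y) (htm : Measurable t) {G : ℝ} (hG : 0 ≤ G)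
    (hν : ∀ x r, 0 < r → ν.real (closedBall x r) ≤ G * r ^ m) :
    ∫ ω, (∫ y, p y ω ∂ν) * (∫ y, p y ω ∂ν) ∂σ ≤ 2 * B * 8 ^ m * G * ν.real univ := by
  have ht0 : ∀ y, 0 < t y := fun y => hε.trans_le (ht y)
  set W : E → E → ℝ := fun y y' => if ‖y' - y‖ ≤ 8 * t y then B / t y ^ m else 0 with hW
  have hWm : Measurable (Function.uncurry W) := by
    refine Measurable.ite (measurableSet_le ?_ ?_) ?_ measurable_const
    · exact (measurable_snd.sub measurable_fst).norm
    · exact (htm.comp measurable_fst).const_mul 8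
    · exact ((htm.comp measurable_fst).pow_const m).const_div B
  have hW0 : ∀ y y', 0 ≤ W y y' := fun y y' => by
    have := ht0 y; simp only [hW]; split_ifs <;> positivity
  have hWb : ∀ y y', |W y y'| ≤ B / ε ^ m := fun y y' => by
    have := ht0 y
    rw [abs_of_nonneg (hW0 _ _)]
    simp only [hW]
    split_ifs
    · gcongr; exact ht y
    · positivity
  have hpair : ∀ y y', t y' ≤ t y → ∫ ω, p y ω * p y' ω ∂σ ≤ W y y' := by
    intro y y' h
    have := ht0 y
    by_cases hd : ‖y' - y‖ ≤ 8 * t y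
    · simp only [hW, if_pos hd]
      calc _ ≤ ∫ ω, B / t y ^ m * p y' ω ∂σ := by
            refine integral_mono
              ((hp.continuous y).mul (hp.continuous y')).integrable_of_compactSpace
              ((hp.integrable y').const_mul _) fun ω => ?_
            exact mul_le_mul_of_nonneg_right (hp.le y ω) (hp.nonneg y' ω)
        _ = B / t y ^ m * ∫ ω, p y' ω ∂σ := integral_const_mul _ _
        _ ≤ B / t y ^ m * 1 := by gcongr; exact hp.integral_le y'
        _ = _ := mul_one _
    · simp only [hW, if_neg hd]
      refine (integral_eq_zero_of_ae (Eventually.of_forall fun ω => ?_)).le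
      show _ = (0 : ℝ)
      by_contra h0
      have h1 := hp.supp _ _ (left_ne_zero_of_mul h0)
      have h2 := hp.supp _ _ (right_ne_zero_of_mul h0)
      have h3 : ‖y' - y‖ ≤ ‖z ω - y‖ + ‖z ω - y'‖ := by
        rw [show y' - y = (z ω - y) - (z ω - y') by abel]
        exact norm_sub_le _ _
      exact hd (by linarith)
  have hH : ∀ y y', ∫ ω, p y ω * p y' ω ∂σ ≤ W y y' + W y' y := by
    intro y y'
    rcases le_total (t y') (t y) with h | h
    · linarith [hpair y y' h, hW0 y' y]
    · have := hpair y' y h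
      simp only [mul_comm (p y' _)] at this
      linarith [hW0 y y']
  have hWi : ∀ y, ∫ y', W y y' ∂ν ≤ B * 8 ^ m * G := by
    intro y
    have := ht0 y
    calc _ ≤ B / t y ^ m * ν.real (closedBall y (8 * t y)) := by
          refine (le_abs_self _).trans (abs_integral_le_of_support (by positivity) fun y' h => ?_)
          have hd : ‖y' - y‖ ≤ 8 * t y := by
            by_contra hd; exact h (if_neg hd)
          exact ⟨mem_closedBall_iff_norm.2 hd, by
            simp only [hW, if_pos hd]; rw [abs_of_nonneg (by positivity)]⟩
      _ ≤ B / t y ^ m * (G * (8 * t y) ^ m) := by gcongr; exact hν _ _ (by positivity)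
      _ = _ := by rw [mul_pow]; field_simp
  have hWm1 : ∀ y, Measurable fun y' => W y y' := fun y => hWm.comp measurable_prodMk_left
  have hWm2 : ∀ y, Measurable fun y' => W y' y := fun y => hWm.comp measurable_prodMk_right
  have hWI1 : Measurable fun y => ∫ y', W y y' ∂ν := measurable_integral_right hWm
  have hWI2 : Measurable fun y => ∫ y', W y' y ∂ν :=
    measurable_integral_right (f := fun y y' => W y' y) (hWm.comp measurable_swap)
  have hint1 : Integrable (fun y => ∫ y', W y y' ∂ν) ν := hWI1.integrable_of_abs_le
    fun y => abs_integral_le_mul_real_univ (by positivity) fun y' => hWb y y'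
  have hint2 : Integrable (fun y => ∫ y', W y' y ∂ν) ν := hWI2.integrable_of_abs_le
    fun y => abs_integral_le_mul_real_univ (by positivity) fun y' => hWb y' y
  have hpb := hp.abs_le hB hε ht
  have hHb : ∀ y y', |∫ ω, p y ω * p y' ω ∂σ| ≤ B / ε ^ m * (B / ε ^ m) * σ.real univ :=
    fun y y' => abs_integral_le_mul_real_univ (by positivity) fun ω => by
      rw [abs_mul]; exact mul_le_mul (hpb _ _) (hpb _ _) (abs_nonneg _) (by positivity)
  have hpm : Measurable (Function.uncurry fun y' y => ∫ ω, p y ω * p y' ω ∂σ) := by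
    refine measurable_integral_right (f := fun (q : E × E) ω => p q.2 ω * p q.1 ω) ?_
    exact (hp.measurable.comp ((measurable_snd.comp measurable_fst).prodMk measurable_snd)).mul
      (hp.measurable.comp ((measurable_fst.comp measurable_fst).prodMk measurable_snd))
  rw [integral_integral_mul_integral hp.measurable hp.measurable hpb hpb]
  calc _ ≤ ∫ y', (∫ y, W y y' ∂ν + ∫ y, W y' y ∂ν) ∂ν := by
        refine integral_mono ?_ (hint2.add hint1) fun y' => ?_
        · refine (measurable_integral_right hpm).integrable_of_abs_le fun y' =>
            abs_integral_le_mul_real_univ (by positivity) fun y => hHb y y'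
        · show _ ≤ _ + _
          rw [← integral_add ((hWm2 y').integrable_of_abs_le fun y => hWb y y')
            ((hWm1 y').integrable_of_abs_le fun y => hWb y' y)]
          exact integral_mono ((hpm.comp measurable_prodMk_left).integrable_of_abs_le
            fun y => hHb y y') (((hWm2 y').integrable_of_abs_le fun y => hWb y y').add
            ((hWm1 y').integrable_of_abs_le fun y => hWb y' y)) fun y => hH y y'
    _ = ∫ y', (∫ y, W y' y ∂ν) ∂ν + ∫ y', (∫ y, W y' y ∂ν) ∂ν := by
        rw [integral_add hint2 hint1]
        congr 1
        exact (integral_integral_swap_of_abs_le hWm hWb).symm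
    _ ≤ 2 * ∫ _, (B * 8 ^ m * G) ∂ν := by
        rw [two_mul]
        exact add_le_add (integral_mono hint1 (integrable_const _) hWi)
          (integral_mono hint1 (integrable_const _) hWi)
    _ = _ := by rw [integral_const, smul_eq_mul]; ring

/-- The smoothed kernel. -/
def smoothedKernel (σ : Measure X) (κ : E → ℝ) (z : X → E) (p : E → X → ℝ) (x y : E) : ℝ :=
  ∫ ω, (∫ ω', κ (z ω - z ω') * p y ω' ∂σ) * p x ω ∂σ

lemma IsBumpFamily.integral_superposition [SecondCountableTopology E]
    (hp : IsBumpFamily m z σ t D B p) (hκ : IsPieceFamily m A κ) (hz : Continuous z) (hA : 0 ≤ A)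
    (hB : 0 ≤ B) {ε r : ℝ} (hε : 0 < ε) (ht : ∀ y, ε ≤ t y) (hr : 0 < r) :
    ∫ ω, (∫ ω', κ r (z ω - z ω') * ∫ y, p y ω' ∂ν ∂σ) * (∫ x, p x ω ∂ν') ∂σ =
      ∫ x, ∫ y, smoothedKernel σ (κ r) z p x y ∂ν ∂ν' := by
  have hpb := hp.abs_le hB hε ht
  have hk := (hκ.continuous_kernel hz hA hr).measurable
  have hkb : ∀ x, |κ r x| ≤ A / r ^ m := fun x => hκ.bound r x hr
  have h1 : ∀ ω, ∫ ω', κ r (z ω - z ω') * ∫ y, p y ω' ∂ν ∂σ =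
      ∫ y, ∫ ω', κ r (z ω - z ω') * p y ω' ∂σ ∂ν := fun ω => by
    simp only [← integral_const_mul]
    refine integral_integral_swap_of_abs_le (C := A / r ^ m * (B / ε ^ m)) ?_ fun ω' y => ?_
    · exact (hk.comp (measurable_const.prodMk measurable_fst)).mul
        (hp.measurable.comp measurable_swap)
    · rw [abs_mul]; exact mul_le_mul (hkb _) (hpb _ _) (abs_nonneg _) (by positivity)
  simp only [h1]
  refine integral_integral_mul_integral (f := fun y ω => ∫ ω', κ r (z ω - z ω') * p y ω' ∂σ)
    (C := A / r ^ m * (B / ε ^ m) * σ.real univ) ?_ hp.measurable (fun y ω => ?_) hpb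
  · refine measurable_integral_right
      (f := fun (q : E × X) ω' => κ r (z q.2 - z ω') * p q.1 ω') ?_
    exact (hk.comp ((measurable_snd.comp measurable_fst).prodMk measurable_snd)).mul
      (hp.measurable.comp ((measurable_fst.comp measurable_fst).prodMk measurable_snd))
  · refine abs_integral_le_mul_real_univ (by positivity) fun ω' => ?_
    rw [abs_mul]; exact mul_le_mul (hkb _) (hpb _ _) (abs_nonneg _) (by positivity)

end Superposition

/-! ### Comparison of a kernel with its smoothed version -/

lemma sum_ite_lt_dyadic_le {ε T : ℝ} (hε : 0 < ε) (hT : 0 ≤ T) (N : ℕ) :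
    ∑ j ∈ Finset.range N, (if ε * 2 ^ j < T then ε * 2 ^ j else 0) ≤ 2 * T := by
  suffices h : ∑ j ∈ Finset.range N, (if ε * 2 ^ j < T then ε * 2 ^ j else 0) ≤
      min (ε * 2 ^ N) (2 * T) from h.trans (min_le_right _ _)
  induction N with
  | zero => simp; exact ⟨hε.le, hT⟩
  | succ N ih =>
    have h1 := ih.trans (min_le_left _ _)
    have h2 := ih.trans (min_le_right _ _)
    have h3 : 0 < ε * 2 ^ N := by positivity
    rw [Finset.sum_range_succ, pow_succ]
    split_ifs with h
    · exact le_min (by linarith) (by linarith)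
    · exact le_min (by linarith) (by linarith)

lemma sum_ite_le_dyadic_inv_le {ε u : ℝ} (hε : 0 < ε) (hu : 0 < u) (k N : ℕ) :
    ∑ j ∈ Finset.range N, (if u ≤ ε * 2 ^ j then 1 / (ε * 2 ^ j) ^ (k + 1) else 0) ≤
      2 / u ^ (k + 1) := by
  suffices h : ∑ j ∈ Finset.range N, (if u ≤ ε * 2 ^ j then 1 / (ε * 2 ^ j) ^ (k + 1) else 0) ≤
      max 0 (2 / u ^ (k + 1) - 2 / (ε * 2 ^ N) ^ (k + 1)) from
    h.trans (max_le (by positivity) (sub_le_self _ (by positivity)))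
  induction N with
  | zero => simp
  | succ N ih =>
    have h3 : 0 < ε * 2 ^ N := by positivity
    rw [Finset.sum_range_succ]
    split_ifs with h
    · refine le_max_of_le_right ?_
      have h4 : 2 / (ε * 2 ^ N) ^ (k + 1) ≤ 2 / u ^ (k + 1) := by gcongr
      rw [max_eq_right (by linarith)] at ih
      have h5 : 2 / (ε * 2 ^ (N + 1)) ^ (k + 1) ≤ 1 / (ε * 2 ^ N) ^ (k + 1) := by
        rw [show ε * 2 ^ (N + 1) = 2 * (ε * 2 ^ N) by ring, mul_pow,
          div_le_div_iff₀ (by positivity) (by positivity), one_mul]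
        gcongr
        exact le_self_pow₀ one_le_two (by omega)
      have h6 : 2 / (ε * 2 ^ N) ^ (k + 1) = 2 * (1 / (ε * 2 ^ N) ^ (k + 1)) := by ring
      linarith
    · refine le_max_of_le_left ?_
      rw [add_zero]
      refine ih.trans (max_le le_rfl (sub_nonpos.2 ?_))
      gcongr
      exact (not_le.1 h).le

section SmoothedKernel

variable {X E : Type*} [NormedAddCommGroup E] [MeasurableSpace E] [TopologicalSpace X]
  [MeasurableSpace X] {m : ℕ} {A B : ℝ} {κ : ℝ → E → ℝ} {z : X → E} {σ : Measure X}
  {t : E → ℝ} {D : Set E} {p : E → X → ℝ}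

lemma norm_sub_le_of_mul_ne_zero (hp : IsBumpFamily m z σ t D B p) (hκ : IsPieceFamily m A κ)
    {r : ℝ} (hr : 0 < r) {x y : E} {ω ω' : X} (h : κ r (z ω - z ω') * p y ω' * p x ω ≠ 0) :
    ‖x - y‖ ≤ 4 * r + 4 * t x + 4 * t y := by
  have h1 := (hκ.supp r _ hr (left_ne_zero_of_mul (left_ne_zero_of_mul h))).2
  have h2 := hp.supp _ _ (right_ne_zero_of_mul (left_ne_zero_of_mul h))
  have h3 := hp.supp _ _ (right_ne_zero_of_mul h)
  rw [show x - y = (z ω - z ω') - (z ω - x) + (z ω' - y) by abel]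
  linarith [norm_add_le ((z ω - z ω') - (z ω - x)) (z ω' - y),
    norm_sub_le (z ω - z ω') (z ω - x)]

lemma norm_sub_le_of_smoothedKernel_ne_zero (hp : IsBumpFamily m z σ t D B p)
    (hκ : IsPieceFamily m A κ) {r : ℝ} (hr : 0 < r) {x y : E}
    (h : smoothedKernel σ (κ r) z p x y ≠ 0) : ‖x - y‖ ≤ 4 * r + 4 * t x + 4 * t y := by
  by_contra hlt
  refine h ?_
  unfold smoothedKernel
  simp only [← integral_mul_const]
  refine integral_eq_zero_of_ae (Eventually.of_forall fun ω => ?_)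
  refine integral_eq_zero_of_ae (Eventually.of_forall fun ω' => ?_)
  by_contra h0
  exact hlt (norm_sub_le_of_mul_ne_zero hp hκ hr h0)

lemma exists_abs_smoothedKernel_le [IsFiniteMeasure σ] (hp : IsBumpFamily m z σ t D B p)
    (hκ : IsPieceFamily m A κ) (hA : 0 ≤ A) (hB : 0 ≤ B) {ε : ℝ} (hε : 0 < ε)
    (ht : ∀ y, ε ≤ t y) {r : ℝ} (hr : 0 < r) :
    ∃ C, ∀ x y, |smoothedKernel σ (κ r) z p x y| ≤ C := by
  have hpb := hp.abs_le hB hε ht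
  refine ⟨A / r ^ m * (B / ε ^ m) * σ.real univ * (B / ε ^ m) * σ.real univ, fun x y => ?_⟩
  refine abs_integral_le_mul_real_univ (by positivity) fun ω => ?_
  rw [abs_mul]
  refine mul_le_mul (abs_integral_le_mul_real_univ (by positivity) fun ω' => ?_) (hpb _ _)
    (abs_nonneg _) (by positivity)
  rw [abs_mul]
  exact mul_le_mul (hκ.bound _ _ hr) (hpb _ _) (abs_nonneg _) (by positivity)

end SmoothedKernel

section Comparison

variable {X : Type*} [MetricSpace X] [CompactSpace X] [MeasurableSpace X] [BorelSpace X]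
  {σ : Measure X} [IsFiniteMeasure σ]
  {E : Type*} [NormedAddCommGroup E] [MeasurableSpace E]
  {m : ℕ} {A a R B : ℝ} {κ : ℝ → E → ℝ} {z : X → E} {t : E → ℝ} {D : Set E} {p : E → X → ℝ}

lemma smoothedKernel_swap (hp : IsBumpFamily m z σ t D B p) (hκ : IsPieceFamily m A κ)
    (hz : Continuous z) (hA : 0 ≤ A) {r : ℝ} (hr : 0 < r) (x y : E) :
    smoothedKernel σ (κ r) z p x y = -smoothedKernel σ (κ r) z p y x := by
  have hk := hκ.continuous_kernel hz hA hr
  unfold smoothedKernel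
  simp only [← integral_mul_const]
  rw [integral_integral_swap_of_continuous, ← integral_neg]
  · refine integral_congr_ae (Eventually.of_forall fun ω => ?_)
    simp only [← integral_neg]
    refine integral_congr_ae (Eventually.of_forall fun ω' => ?_)
    simp only [hκ.kernel_symm r (z ω') (z ω)]
    ring
  · exact (hk.mul ((hp.continuous y).comp continuous_snd)).mul
      ((hp.continuous x).comp continuous_fst)

/-- Smoothing at a scale finer than that of the kernel changes it little. -/
lemma abs_sub_smoothedKernel_le (hp : IsBumpFamily m z σ t D B p) (hκ : IsPieceFamily m A κ)
    (hz : Continuous z) (hA : 0 ≤ A) {r : ℝ} (hr : 0 < r) {x y : E} (hx : x ∈ D) (hy : y ∈ D)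
    {T : ℝ} (hxT : t x ≤ T) (hyT : t y ≤ T) :
    |κ r (x - y) - smoothedKernel σ (κ r) z p x y| ≤ 8 * A * T / r ^ (m + 1) := by
  have hk := hκ.continuous_kernel hz hA hr
  have hc : ∀ ω, Continuous fun ω' => κ r (z ω - z ω') * p y ω' := fun ω =>
    (hk.comp (Continuous.prodMk_right ω)).mul (hp.continuous y)
  have hcc : Continuous fun ω => ∫ ω', κ r (z ω - z ω') * p y ω' ∂σ := by
    refine continuous_parametric_integral_of_continuous (s := univ) ?_ isCompact_univ |>.congr
      fun ω => by rw [Measure.restrict_univ]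
    exact hk.mul ((hp.continuous y).comp continuous_snd)
  have h1 : κ r (x - y) = ∫ ω, κ r (x - y) * p x ω ∂σ := by
    rw [integral_const_mul, hp.integral_eq x hx, mul_one]
  have h2 : ∀ ω, κ r (x - y) - ∫ ω', κ r (z ω - z ω') * p y ω' ∂σ =
      ∫ ω', (κ r (x - y) - κ r (z ω - z ω')) * p y ω' ∂σ := fun ω => by
    simp only [sub_mul]
    rw [integral_sub ((hp.integrable y).const_mul _) (hc ω).integrable_of_compactSpace,
      integral_const_mul, hp.integral_eq y hy, mul_one]
  have h3 : κ r (x - y) - smoothedKernel σ (κ r) z p x y =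
      ∫ ω, (κ r (x - y) - ∫ ω', κ r (z ω - z ω') * p y ω' ∂σ) * p x ω ∂σ := by
    simp only [sub_mul]
    have h := integral_sub (μ := σ) ((hp.integrable x).const_mul (κ r (x - y)))
      (hcc.mul (hp.continuous x)).integrable_of_compactSpace
    rw [← h1] at h
    exact h.symm
  have hbound : ∀ ω, p x ω ≠ 0 → |κ r (x - y) - ∫ ω', κ r (z ω - z ω') * p y ω' ∂σ| ≤
      8 * A * T / r ^ (m + 1) := by
    intro ω hω
    rw [h2, ← Real.norm_eq_abs]
    refine (norm_integral_le_of_norm_le ((hp.integrable y).const_mul (8 * A * T / r ^ (m + 1)))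
      (Eventually.of_forall fun ω' => ?_)).trans (le_of_eq ?_)
    · rw [norm_mul, Real.norm_eq_abs, Real.norm_eq_abs, abs_of_nonneg (hp.nonneg y ω')]
      by_cases h0 : p y ω' = 0
      · simp [h0]
      refine mul_le_mul_of_nonneg_right ((hκ.lip r _ _ hr).trans ?_) (hp.nonneg _ _)
      have h4 := hp.supp _ _ hω
      have h5 := hp.supp _ _ h0
      have h6 : ‖x - y - (z ω - z ω')‖ ≤ 8 * T := by
        rw [show x - y - (z ω - z ω') = (z ω' - y) - (z ω - x) by abel]
        linarith [norm_sub_le (z ω' - y) (z ω - x)]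
      calc _ ≤ A * (8 * T) / r ^ (m + 1) := by gcongr
        _ = _ := by ring
    · rw [integral_const_mul, hp.integral_eq y hy, mul_one]
  rw [h3, ← Real.norm_eq_abs]
  refine (norm_integral_le_of_norm_le ((hp.integrable x).const_mul (8 * A * T / r ^ (m + 1)))
    (Eventually.of_forall fun ω => ?_)).trans (le_of_eq ?_)
  · rw [norm_mul, Real.norm_eq_abs, Real.norm_eq_abs, abs_of_nonneg (hp.nonneg x ω)]
    by_cases h0 : p x ω = 0
    · simp [h0]
    exact mul_le_mul_of_nonneg_right (hbound ω h0) (hp.nonneg _ _)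
  · rw [integral_const_mul, hp.integral_eq x hx, mul_one]

/-- A kernel at a scale finer than that of the smoothing is nearly cancelled by it. -/
lemma abs_smoothedKernel_le_left (hp : IsBumpFamily m z σ t D B p) (hκ : IsPieceFamily m A κ)
    (hz : Continuous z) (hσ : IsRegularSurface m κ z σ A a R) (hA : 0 ≤ A) (hB : 0 ≤ B)
    (ht0 : ∀ y, 0 < t y) {r : ℝ} (hr : 0 < r) (x y : E) :
    |smoothedKernel σ (κ r) z p x y| ≤
      (4 ^ (m + 1) * A ^ 2 * (B / t y ^ (m + 1)) + A * (B / t y ^ m)) * r := by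
  have := ht0 y
  unfold smoothedKernel
  rw [← Real.norm_eq_abs]
  refine (norm_integral_le_of_norm_le ((hp.integrable x).const_mul _)
    (Eventually.of_forall fun ω => ?_)).trans
    ((integral_const_mul _ _).trans_le (mul_le_of_le_one_right ?_ (hp.integral_le x)))
  · rw [norm_mul, Real.norm_eq_abs, Real.norm_eq_abs, abs_of_nonneg (hp.nonneg x ω)]
    refine mul_le_mul_of_nonneg_right ?_ (hp.nonneg _ _)
    refine abs_integral_kernel_mul_le hκ hz hσ hA hr (hp.continuous y) (by positivity)
      (fun ω' => hp.lip y ω' ω |>.trans_eq rfl) ?_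
    rw [abs_of_nonneg (hp.nonneg _ _)]
    exact hp.le y ω
  · positivity

lemma abs_smoothedKernel_le (hp : IsBumpFamily m z σ t D B p) (hκ : IsPieceFamily m A κ)
    (hz : Continuous z) (hσ : IsRegularSurface m κ z σ A a R) (hA : 0 ≤ A) (hB : 0 ≤ B)
    (ht0 : ∀ y, 0 < t y) {r : ℝ} (hr : 0 < r) (x y : E) :
    |smoothedKernel σ (κ r) z p x y| ≤ (4 ^ (m + 1) * A ^ 2 * (B / max (t x) (t y) ^ (m + 1)) +
      A * (B / max (t x) (t y) ^ m)) * r := by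
  rcases le_total (t x) (t y) with h | h
  · rw [max_eq_right h]
    exact abs_smoothedKernel_le_left hp hκ hz hσ hA hB ht0 hr x y
  · rw [max_eq_left h, smoothedKernel_swap hp hκ hz hA hr, abs_neg]
    exact abs_smoothedKernel_le_left hp hκ hz hσ hA hB ht0 hr y x

lemma abs_sub_smoothedKernel_le_add (hp : IsBumpFamily m z σ t D B p) (hκ : IsPieceFamily m A κ)
    (hz : Continuous z) (hσ : IsRegularSurface m κ z σ A a R) (hA : 0 ≤ A) (hB : 0 ≤ B)
    (ht0 : ∀ y, 0 < t y) {r : ℝ} (hr : 0 < r) {x y : E} (hx : x ∈ D) (hy : y ∈ D)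
    {T s : ℝ} (hT : T = max (t x) (t y)) (hs : s = T + ‖x - y‖) (hTR : T ≤ 2 * R)
    (hsep : T ≤ ‖x - y‖ + r) :
    |κ r (x - y) - smoothedKernel σ (κ r) z p x y| ≤
      8 * A * T * (if s / 13 ≤ r then 1 / r ^ (m + 1) else 0) +
      (A * 9 ^ (m + 1) + (4 ^ (m + 1) * A ^ 2 * B + 2 * A * B * R) * 13 ^ (m + 1)) / s ^ (m + 1) *
        (if r < T then r else 0) := by
  have hxT : t x ≤ T := hT ▸ le_max_left _ _
  have hyT : t y ≤ T := hT ▸ le_max_right _ _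
  have hT0 : 0 < T := (ht0 x).trans_le hxT
  have hR : 0 < R := by linarith
  have hs0 : 0 < s := by rw [hs]; positivity
  have hn := norm_nonneg (x - y)
  by_cases hrT : r < T
  · rw [if_pos hrT]
    have h1 : |κ r (x - y)| ≤ A * 9 ^ (m + 1) / s ^ (m + 1) * r := by
      by_cases h0 : κ r (x - y) = 0
      · rw [h0, abs_zero]; positivity
      have h4 := (hκ.supp r _ hr h0).2
      refine (hκ.bound r _ hr).trans ?_
      calc A / r ^ m = A * 9 ^ (m + 1) / (9 * r) ^ (m + 1) * r := by
            rw [mul_pow]; field_simp; ring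
        _ ≤ _ := by gcongr; linarith
    have h2 : |smoothedKernel σ (κ r) z p x y| ≤
        (4 ^ (m + 1) * A ^ 2 * B + 2 * A * B * R) * 13 ^ (m + 1) / s ^ (m + 1) * r := by
      by_cases h0 : smoothedKernel σ (κ r) z p x y = 0
      · rw [h0, abs_zero]; positivity
      have h4 := norm_sub_le_of_smoothedKernel_ne_zero hp hκ hr h0
      refine (abs_smoothedKernel_le hp hκ hz hσ hA hB ht0 hr x y).trans ?_
      rw [← hT]
      refine mul_le_mul_of_nonneg_right ?_ hr.le
      calc _ = (4 ^ (m + 1) * A ^ 2 * B + A * B * T) * 13 ^ (m + 1) / (13 * T) ^ (m + 1) := by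
            rw [mul_pow]; field_simp; ring
        _ ≤ (4 ^ (m + 1) * A ^ 2 * B + A * B * (2 * R)) * 13 ^ (m + 1) / s ^ (m + 1) := by
            gcongr; linarith
        _ = _ := by ring
    have h3 : 0 ≤ 8 * A * T * (if s / 13 ≤ r then 1 / r ^ (m + 1) else 0) := by
      split_ifs <;> positivity
    calc _ ≤ |κ r (x - y)| + |smoothedKernel σ (κ r) z p x y| := abs_sub _ _
      _ ≤ _ := add_le_add h1 h2
      _ = (A * 9 ^ (m + 1) + (4 ^ (m + 1) * A ^ 2 * B + 2 * A * B * R) * 13 ^ (m + 1)) /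
          s ^ (m + 1) * r := by ring
      _ ≤ _ := le_add_of_nonneg_left h3
  · rw [if_neg hrT, mul_zero, add_zero]
    rw [not_lt] at hrT
    by_cases h0 : κ r (x - y) - smoothedKernel σ (κ r) z p x y = 0
    · rw [h0, abs_zero]
      split_ifs <;> positivity
    have h4 : ‖x - y‖ ≤ 12 * r := by
      by_cases h5 : κ r (x - y) = 0
      · have := norm_sub_le_of_smoothedKernel_ne_zero hp hκ hr (x := x) (y := y) fun h6 => h0 (by
          rw [h5, h6, sub_zero])
        linarith
      · linarith [(hκ.supp r _ hr h5).2]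
    rw [if_pos (by linarith)]
    exact (abs_sub_smoothedKernel_le hp hκ hz hA hr hx hy hxT hyT).trans_eq (by ring)

lemma exists_sum_abs_sub_smoothedKernel_le (hκ : IsPieceFamily m A κ)
    (hz : Continuous z) (hσ : IsRegularSurface m κ z σ A a R) (hA : 0 ≤ A) (hB : 0 ≤ B)
    (hR : 0 < R) : ∃ C, 0 ≤ C ∧ ∀ (t : E → ℝ) (D : Set E) (p : E → X → ℝ),
      IsBumpFamily m z σ t D B p → (∀ y, 0 < t y) →
      ∀ ε N, 0 < ε → ∀ x ∈ D, ∀ y ∈ D, max (t x) (t y) ≤ 2 * R →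
        max (t x) (t y) ≤ ‖x - y‖ + ε →
        ∑ j ∈ Finset.range N, |κ (ε * 2 ^ j) (x - y) -
          smoothedKernel σ (κ (ε * 2 ^ j)) z p x y| ≤
        C * (max (t x) (t y) / (max (t x) (t y) + ‖x - y‖) ^ (m + 1)) := by
  set C₂ := A * 9 ^ (m + 1) + (4 ^ (m + 1) * A ^ 2 * B + 2 * A * B * R) * 13 ^ (m + 1) with hC₂
  refine ⟨16 * A * 13 ^ (m + 1) + 2 * C₂, by positivity, ?_⟩
  intro t D p hp ht0 ε N hε x hx y hy hTR hsep
  set T := max (t x) (t y) with hT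
  set s := T + ‖x - y‖ with hs
  have hT0 : 0 < T := (ht0 x).trans_le (le_max_left _ _)
  have hs0 : 0 < s := by positivity
  have hr : ∀ j : ℕ, ε ≤ ε * 2 ^ j := fun j => le_mul_of_one_le_right hε.le (one_le_pow₀ one_le_two)
  calc _ ≤ ∑ j ∈ Finset.range N,
        (8 * A * T * (if s / 13 ≤ ε * 2 ^ j then 1 / (ε * 2 ^ j) ^ (m + 1) else 0) +
          C₂ / s ^ (m + 1) * (if ε * 2 ^ j < T then ε * 2 ^ j else 0)) :=
        Finset.sum_le_sum fun j _ => abs_sub_smoothedKernel_le_add hp hκ hz hσ hA hB ht0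
          (by positivity) hx hy hT hs hTR (by linarith [hr j])
    _ ≤ 8 * A * T * (2 / (s / 13) ^ (m + 1)) + C₂ / s ^ (m + 1) * (2 * T) := by
        rw [Finset.sum_add_distrib, ← Finset.mul_sum, ← Finset.mul_sum]
        gcongr
        · exact sum_ite_le_dyadic_inv_le hε (by positivity) m N
        · exact sum_ite_lt_dyadic_le hε hT0.le N
    _ = _ := by rw [div_pow]; field_simp; ring

end Comparison

/-! ### Potentials of measures of codimension one -/

section Potential

variable {E : Type*} [NormedAddCommGroup E] [MeasurableSpace E] [BorelSpace E]
  {μ : Measure E} {m : ℕ} {G : ℝ}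

lemma lintegral_div_pow_le (hG : 0 ≤ G)
    (hμ : ∀ x r, 0 < r → μ (closedBall x r) ≤ ENNReal.ofReal (G * r ^ m)) {a : ℝ} (ha : 0 ≤ a)
    (x : E) :
    ∫⁻ y, ENNReal.ofReal (a / (a + ‖x - y‖) ^ (m + 1)) ∂μ ≤ ENNReal.ofReal (2 ^ (m + 1) * G) := by
  rcases ha.eq_or_lt with rfl | ha
  · simp
  set w : ℕ → E → ℝ≥0∞ := fun k => (closedBall x (a * 2 ^ (k + 1))).indicator
    fun _ => ENNReal.ofReal (a / (a * 2 ^ k) ^ (m + 1)) with hw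
  have hpt : ∀ y, ENNReal.ofReal (a / (a + ‖x - y‖) ^ (m + 1)) ≤ ∑' k, w k y := by
    intro y
    have hn := norm_nonneg (x - y)
    obtain ⟨k, hk1, hk2⟩ := exists_nat_pow_near (x := (a + ‖x - y‖) / a) (y := 2)
      (by rw [le_div_iff₀ ha]; linarith) one_lt_two
    rw [le_div_iff₀ ha] at hk1
    rw [div_lt_iff₀ ha] at hk2
    refine le_trans ?_ (ENNReal.le_tsum k)
    have hy : y ∈ closedBall x (a * 2 ^ (k + 1)) := by
      rw [mem_closedBall_iff_norm, norm_sub_rev]; linarith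
    simp only [hw, indicator_of_mem hy]
    refine ENNReal.ofReal_le_ofReal ?_
    gcongr
    linarith
  calc _ ≤ ∫⁻ y, ∑' k, w k y ∂μ := lintegral_mono hpt
    _ = ∑' k, ∫⁻ y, w k y ∂μ := lintegral_tsum fun k =>
        (measurable_const.indicator measurableSet_closedBall).aemeasurable
    _ ≤ ∑' k : ℕ, ENNReal.ofReal (2 ^ m * G * (1 / 2) ^ k) := by
        refine ENNReal.tsum_le_tsum fun k => ?_
        rw [lintegral_indicator_const measurableSet_closedBall]
        refine (mul_le_mul_right (hμ x (a * 2 ^ (k + 1)) (by positivity)) _).trans ?_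
        rw [← ENNReal.ofReal_mul (by positivity)]
        refine ENNReal.ofReal_le_ofReal (le_of_eq ?_)
        rw [show a * 2 ^ (k + 1) = 2 * (a * 2 ^ k) by ring, mul_pow 2, one_div, inv_pow]
        field_simp
        ring
    _ = _ := by
        rw [← ENNReal.ofReal_tsum_of_nonneg (fun k => by positivity)
          (summable_geometric_two.mul_left _), tsum_mul_left, tsum_geometric_two]
        congr 1; ring

/-- The potential `x ↦ ∫ d(y) / (d(y) + |x - y|) ^ (m + 1) dμ(y)`. -/
def weightedPotential (μ : Measure E) (m : ℕ) (d : E → ℝ) (x : E) : ℝ≥0∞ :=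
  ∫⁻ y, ENNReal.ofReal (d y / (d y + ‖x - y‖) ^ (m + 1)) ∂μ

variable [SecondCountableTopology E] {d : E → ℝ}

lemma measurable_div_pow (hd : Measurable d) : Measurable (Function.uncurry fun x y : E =>
    ENNReal.ofReal (d y / (d y + ‖x - y‖) ^ (m + 1))) := by
  have h1 : Measurable fun q : E × E => d q.2 := hd.comp measurable_snd
  exact (h1.div ((h1.add (measurable_fst.sub measurable_snd).norm).pow_const _)).ennreal_ofReal

lemma lintegral_weightedPotential_lt_top [IsFiniteMeasure μ] (hG : 0 ≤ G)
    (hμ : ∀ x r, 0 < r → μ (closedBall x r) ≤ ENNReal.ofReal (G * r ^ m)) (hd : Measurable d)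
    (hd0 : ∀ y, 0 ≤ d y) : ∫⁻ x, weightedPotential μ m d x ∂μ < ∞ := by
  unfold weightedPotential
  rw [lintegral_lintegral_swap (measurable_div_pow hd).aemeasurable]
  refine (lintegral_mono (g := fun _ => ENNReal.ofReal (2 ^ (m + 1) * G)) fun y => ?_).trans_lt ?_
  · simp only [fun x => norm_sub_rev x y]
    exact lintegral_div_pow_le hG hμ (hd0 y) y
  · rw [lintegral_const]
    exact ENNReal.mul_lt_top ENNReal.ofReal_lt_top (measure_lt_top _ _)

lemma add_div_pow_le {a ε ρ : ℝ} (ha : 0 ≤ a) (hε : 0 < ε) (hρ : 0 ≤ ρ) :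
    (a + ε) / (a + ε + ρ) ^ (m + 1) ≤ a / (a + ρ) ^ (m + 1) + ε / (ε + ρ) ^ (m + 1) := by
  rw [add_div]
  refine add_le_add ?_ ?_
  · rcases ha.eq_or_lt with rfl | ha
    · simp
    · gcongr; linarith
  · gcongr; linarith

lemma max_add_div_pow_le {a b ε ρ : ℝ} (ha : 0 ≤ a) (hb : 0 ≤ b) (hε : 0 < ε) (hρ : 0 ≤ ρ) :
    max (a + ε) (b + ε) / (max (a + ε) (b + ε) + ρ) ^ (m + 1) ≤
      a / (a + ρ) ^ (m + 1) + b / (b + ρ) ^ (m + 1) + ε / (ε + ρ) ^ (m + 1) := by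
  have h1 : 0 ≤ a / (a + ρ) ^ (m + 1) := by positivity
  have h2 : 0 ≤ b / (b + ρ) ^ (m + 1) := by positivity
  rcases max_choice (a + ε) (b + ε) with h | h <;> rw [h]
  · linarith [add_div_pow_le (m := m) ha hε hρ]
  · linarith [add_div_pow_le (m := m) hb hε hρ]

lemma lintegral_max_add_div_pow_le (hG : 0 ≤ G)
    (hμ : ∀ x r, 0 < r → μ (closedBall x r) ≤ ENNReal.ofReal (G * r ^ m)) (hd : Measurable d)
    (hd0 : ∀ y, 0 ≤ d y) {ε : ℝ} (hε : 0 < ε) (x : E) :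
    ∫⁻ y, ENNReal.ofReal (max (d x + ε) (d y + ε) /
        (max (d x + ε) (d y + ε) + ‖x - y‖) ^ (m + 1)) ∂μ ≤
      2 * ENNReal.ofReal (2 ^ (m + 1) * G) + weightedPotential μ m d x := by
  have hmeas : ∀ f : E → ℝ, Measurable f → Measurable fun y : E =>
      ENNReal.ofReal (f y / (f y + ‖x - y‖) ^ (m + 1)) := fun f hf =>
    (measurable_div_pow hf).comp measurable_prodMk_left
  have hpt : ∀ y, ENNReal.ofReal (max (d x + ε) (d y + ε) /
        (max (d x + ε) (d y + ε) + ‖x - y‖) ^ (m + 1)) ≤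
      ENNReal.ofReal (d x / (d x + ‖x - y‖) ^ (m + 1)) +
        ENNReal.ofReal (d y / (d y + ‖x - y‖) ^ (m + 1)) +
        ENNReal.ofReal (ε / (ε + ‖x - y‖) ^ (m + 1)) := fun y =>
    (ENNReal.ofReal_le_ofReal (max_add_div_pow_le (hd0 x) (hd0 y) hε (norm_nonneg _))).trans
      (ENNReal.ofReal_add_le.trans (add_le_add_left ENNReal.ofReal_add_le _))
  refine (lintegral_mono hpt).trans ?_
  rw [lintegral_add_right _ (hmeas _ measurable_const), lintegral_add_right _ (hmeas d hd)]
  have h1 := lintegral_div_pow_le hG hμ (hd0 x) x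
  have h2 := lintegral_div_pow_le hG hμ hε.le x
  calc _ ≤ ENNReal.ofReal (2 ^ (m + 1) * G) + weightedPotential μ m d x +
      ENNReal.ofReal (2 ^ (m + 1) * G) := add_le_add (add_le_add_left h1 _) h2
    _ = _ := by ring

lemma setLIntegral_setLIntegral_div_pow_le (hG : 0 ≤ G)
    (hμ : ∀ x r, 0 < r → μ (closedBall x r) ≤ ENNReal.ofReal (G * r ^ m)) (hd : Measurable d)
    (hd0 : ∀ y, 0 ≤ d y) {ε : ℝ} (hε : 0 < ε) (P Q : Set E) :
    ∫⁻ x in Q, ∫⁻ y in P, ENNReal.ofReal (max (d x + ε) (d y + ε) /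
        (max (d x + ε) (d y + ε) + ‖x - y‖) ^ (m + 1)) ∂μ ∂μ ≤
      2 * ENNReal.ofReal (2 ^ (m + 1) * G) * μ Q + ∫⁻ x in Q, weightedPotential μ m d x ∂μ := by
  refine (lintegral_mono fun x => (setLIntegral_le_lintegral _ _).trans
    (lintegral_max_add_div_pow_le hG hμ hd hd0 hε x)).trans_eq ?_
  rw [lintegral_add_left measurable_const, lintegral_const, Measure.restrict_apply_univ]

end Potential

/-! ### The truncated kernel -/

section TruncatedKernel

variable {E : Type*} [NormedAddCommGroup E] {K : E → ℝ} {C ε : ℝ} {m : ℕ}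

/-- The kernel `K` truncated at distance `ε`. -/
def truncKernel (K : E → ℝ) (ε : ℝ) (v : E) : ℝ := if ε < ‖v‖ then K v else 0

lemma abs_truncKernel_le (hC : 0 ≤ C) (hK : ∀ x, x ≠ 0 → |K x| ≤ C / ‖x‖ ^ m) (hε : 0 < ε)
    (v : E) : |truncKernel K ε v| ≤ C / ε ^ m := by
  unfold truncKernel
  split_ifs with h
  · refine (hK v (norm_pos_iff.1 (hε.trans h))).trans ?_
    gcongr
  · rw [abs_zero]; positivity

lemma truncKernel_neg (hodd : ∀ x, x ≠ 0 → K (-x) = -K x) (hε : 0 < ε) (v : E) :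
    truncKernel K ε (-v) = -truncKernel K ε v := by
  unfold truncKernel
  rw [norm_neg]
  split_ifs with h
  · exact hodd v (norm_pos_iff.1 (hε.trans h))
  · exact neg_zero.symm

lemma measurable_truncKernel [MeasurableSpace E] [OpensMeasurableSpace E] (hKm : Measurable K) :
    Measurable (truncKernel K ε) :=
  Measurable.ite (measurableSet_lt measurable_const measurable_norm) hKm measurable_const

lemma abs_truncKernel_sub_sum_le (hC : 0 ≤ C) (hK : ∀ x, x ≠ 0 → |K x| ≤ C / ‖x‖ ^ m) (hε : 0 < ε)
    {N : ℕ} {v : E} (hv : ‖v‖ ≤ ε * 2 ^ N) {T : ℝ} (hεT : ε ≤ T) (hT : T ≤ ‖v‖ + ε) :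
    |truncKernel K ε v - ∑ j ∈ Finset.range N, kernelPiece K (ε * 2 ^ j) v| ≤
      C * 5 ^ (m + 1) * (T / (T + ‖v‖) ^ (m + 1)) := by
  have hT0 : 0 < T := hε.trans_le hεT
  have hn := norm_nonneg v
  rw [sum_kernelPiece, ramp_of_le (s := ‖v‖ / (ε * 2 ^ N)) (div_le_one_of_le₀ hv (by positivity)),
    sub_zero]
  unfold truncKernel
  split_ifs with h
  · rcases le_or_gt (2 * ε) ‖v‖ with h2 | h2
    · rw [ramp_of_ge ((le_div_iff₀ hε).2 h2), one_mul, sub_self, abs_zero]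
      positivity
    · have h1 : |1 - ramp (‖v‖ / ε)| ≤ 1 := abs_le.2
        ⟨by linarith [ramp_le_one (‖v‖ / ε)], by linarith [ramp_nonneg (‖v‖ / ε)]⟩
      calc _ = |1 - ramp (‖v‖ / ε)| * |K v| := by rw [← abs_mul]; congr 1; ring
        _ ≤ 1 * (C / ‖v‖ ^ m) :=
            mul_le_mul h1 (hK v (norm_pos_iff.1 (hε.trans h))) (abs_nonneg _) zero_le_one
        _ ≤ C / ε ^ m := by rw [one_mul]; gcongr
        _ = C * 5 ^ (m + 1) * (ε / (5 * ε) ^ (m + 1)) := by rw [mul_pow]; field_simp; ring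
        _ ≤ _ := by gcongr; linarith
  · rw [ramp_of_le (div_le_one_of_le₀ (not_lt.1 h) hε.le), zero_mul, sub_self, abs_zero]
    positivity

end TruncatedKernel

/-! ### The truncated form near a sphere -/

section SmoothedForm

variable {X : Type*} [MetricSpace X] [CompactSpace X] [MeasurableSpace X] [BorelSpace X]
  {σ : Measure X} [IsFiniteMeasure σ]
  {E : Type*} [NormedAddCommGroup E] [MeasurableSpace E]
  {m : ℕ} {A a R B G ε : ℝ} {κ : ℝ → E → ℝ} {z : X → E} {t : E → ℝ} {D : Set E} {p : E → X → ℝ}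

lemma measurable_smoothedKernel (hp : IsBumpFamily m z σ t D B p) (hκ : IsPieceFamily m A κ)
    (hz : Continuous z) (hA : 0 ≤ A) {r : ℝ} (hr : 0 < r) :
    Measurable (Function.uncurry (smoothedKernel σ (κ r) z p)) := by
  have hk := (hκ.continuous_kernel hz hA hr).measurable
  have h1 : Measurable (Function.uncurry fun (q : E × X) (ω' : X) =>
      κ r (z q.2 - z ω') * p q.1 ω') :=
    (hk.comp ((measurable_snd.comp measurable_fst).prodMk measurable_snd)).mul
      (hp.measurable.comp ((measurable_fst.comp measurable_fst).prodMk measurable_snd))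
  have h2 : Measurable fun q : E × X => ∫ ω', κ r (z q.2 - z ω') * p q.1 ω' ∂σ :=
    measurable_integral_right h1
  refine measurable_integral_right
    (f := fun (q : E × E) ω => (∫ ω', κ r (z ω - z ω') * p q.2 ω' ∂σ) * p q.1 ω) ?_
  exact (h2.comp ((measurable_snd.comp measurable_fst).prodMk measurable_snd)).mul
    (hp.measurable.comp ((measurable_fst.comp measurable_fst).prodMk measurable_snd))

variable [BorelSpace E] [SecondCountableTopology E]

lemma exists_abs_sum_integral_smoothedKernel_le (hκ : IsPieceFamily m A κ) (hz : Continuous z)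
    (hσ : IsRegularSurface m κ z σ A a R) (hA : 0 ≤ A) (hB : 0 ≤ B) (hG : 0 ≤ G) {ρ : ℝ}
    (hρ : 0 ≤ ρ) : ∃ C, 0 ≤ C ∧ ∀ (t : E → ℝ) (D : Set E) (p : E → X → ℝ),
      IsBumpFamily m z σ t D B p → Measurable t → ∀ ε N, 0 < ε → (∀ y, ε ≤ t y) → ε * 2 ^ N ≤ ρ →
      ∀ (ν ν' : Measure E) [IsFiniteMeasure ν] [IsFiniteMeasure ν'],
        (∀ x r, 0 < r → ν.real (closedBall x r) ≤ G * r ^ m) →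
        (∀ x r, 0 < r → ν'.real (closedBall x r) ≤ G * r ^ m) →
        |∑ j ∈ Finset.range N, ∫ x, ∫ y, smoothedKernel σ (κ (ε * 2 ^ j)) z p x y ∂ν ∂ν'| ≤
          C * √(ν.real univ * ν'.real univ) := by
  obtain ⟨Λ, hΛ, h⟩ := exists_sq_integral_sum_piece_le hκ hz hσ hA hρ
  refine ⟨√Λ * (2 * B * 8 ^ m * G), by positivity, ?_⟩
  intro t D p hp htm ε N hε ht hN ν ν' _ _ hν hν'
  have h1 := h ε N hε hN ⟨_, hp.continuous_integral (ν := ν) hB hε ht⟩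
    ⟨_, hp.continuous_integral (ν := ν') hB hε ht⟩
  simp only [ContinuousMap.coe_mk] at h1
  have h2 : ∀ j, ∫ ω, (∫ ω', κ (ε * 2 ^ j) (z ω - z ω') * ∫ y, p y ω' ∂ν ∂σ) *
      (∫ x, p x ω ∂ν') ∂σ = ∫ x, ∫ y, smoothedKernel σ (κ (ε * 2 ^ j)) z p x y ∂ν ∂ν' := fun j =>
    hp.integral_superposition hκ hz hA hB hε ht (by positivity)
  simp only [h2] at h1
  have h3 := hp.integral_sq_le hB hε ht htm hG hν
  have h4 := hp.integral_sq_le hB hε ht htm hG hν'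
  refine abs_le_of_sq_le_sq ?_ (by positivity)
  refine h1.trans ?_
  rw [mul_pow, mul_pow, Real.sq_sqrt hΛ, Real.sq_sqrt (by positivity)]
  calc _ ≤ Λ * (2 * B * 8 ^ m * G * ν.real univ) * (2 * B * 8 ^ m * G * ν'.real univ) := by
        refine mul_le_mul (mul_le_mul_of_nonneg_left h3 hΛ) h4
          (integral_nonneg fun ω => mul_self_nonneg _) (by positivity)
    _ = _ := by ring

end SmoothedForm

section NearSphere

variable {E : Type*} [NormedAddCommGroup E] {m : ℕ} {K : E → ℝ} {C G R : ℝ}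

/-- The distance to the sphere with center `c` and radius `R`. -/
def sphereDist (c : E) (R : ℝ) (y : E) : ℝ := |‖y - c‖ - R|

lemma continuous_sphereDist (c : E) (R : ℝ) : Continuous (sphereDist c R) := by
  unfold sphereDist; fun_prop

variable [InnerProductSpace ℝ E]

lemma exists_norm_sub_eq_sphereDist [Nontrivial E] (c : E) (hR : 0 < R) (y : E) :
    ∃ ω : sphere (0 : E) 1, ‖c + R • (ω : E) - y‖ = sphereDist c R y := by
  by_cases hy : y - c = 0
  · obtain ⟨ω, hω⟩ := NormedSpace.sphere_nonempty (x := (0 : E)) (r := 1) |>.2 zero_le_one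
    refine ⟨⟨ω, hω⟩, ?_⟩
    rw [mem_sphere_zero_iff_norm] at hω
    rw [sphereDist, hy, norm_zero, zero_sub, abs_neg, abs_of_pos hR,
      show c + R • ω - y = R • ω - (y - c) by abel, hy, sub_zero, norm_smul, hω, mul_one,
      Real.norm_of_nonneg hR.le]
  · have h0 : ‖y - c‖ ≠ 0 := norm_ne_zero_iff.2 hy
    refine ⟨⟨‖y - c‖⁻¹ • (y - c), by simp [norm_smul, h0]⟩, ?_⟩
    have : c + R • (‖y - c‖⁻¹ • (y - c)) - y = (R * ‖y - c‖⁻¹ - 1) • (y - c) := by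
      rw [sub_smul, smul_smul, one_smul]; abel
    rw [show c + R • (((⟨‖y - c‖⁻¹ • (y - c), _⟩ : sphere (0 : E) 1)) : E) - y =
      c + R • (‖y - c‖⁻¹ • (y - c)) - y from rfl, this, norm_smul, sphereDist, ← abs_neg,
      Real.norm_eq_abs, ← abs_of_nonneg (norm_nonneg (y - c)), ← abs_mul,
      abs_of_nonneg (norm_nonneg (y - c))]
    congr 1; field_simp; ring

variable [FiniteDimensional ℝ E] [MeasurableSpace E] [BorelSpace E]

theorem exists_abs_integral_truncKernel_le (hm : Module.finrank ℝ E = m + 1) (hC : 0 ≤ C)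
    (hodd : ∀ x, x ≠ 0 → K (-x) = -K x) (hK : ∀ x, x ≠ 0 → |K x| ≤ C / ‖x‖ ^ m)
    (hd : ∀ x, x ≠ 0 → DifferentiableAt ℝ K x)
    (hgrad : ∀ x, x ≠ 0 → ‖fderiv ℝ K x‖ ≤ C / ‖x‖ ^ (m + 1)) (hKm : Measurable K)
    {μ : Measure E} [IsFiniteMeasure μ] (hG : 0 ≤ G)
    (hμ : ∀ x r, 0 < r → μ (closedBall x r) ≤ ENNReal.ofReal (G * r ^ m)) (c : E) (hR : 0 < R) :
    ∃ M, 0 ≤ M ∧ ∀ ε, 0 < ε → ε ≤ R → ∀ P Q : Set E, MeasurableSet P → MeasurableSet Q →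
      (∀ x ∈ Q, ∀ y ∈ P, sphereDist c R x ≤ ‖x - y‖ ∧ sphereDist c R y ≤ ‖x - y‖ ∧
        sphereDist c R x ≤ R ∧ sphereDist c R y ≤ R) →
      |∫ x in Q, ∫ y in P, truncKernel K ε (x - y) ∂μ ∂μ| ≤ M * √(μ.real P * μ.real Q) +
        (ENNReal.ofReal M * (2 * ENNReal.ofReal (2 ^ (m + 1) * G) * μ Q +
          ∫⁻ x in Q, weightedPotential μ m (sphereDist c R) x ∂μ)).toReal := by
  have : Nontrivial E := Module.nontrivial_of_finrank_pos (R := ℝ) (by omega)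
  set κ := kernelPiece K
  set d := sphereDist c R
  have hdc : Continuous d := continuous_sphereDist c R
  have hd0 : ∀ y, 0 ≤ d y := fun y => abs_nonneg _
  have hκ₀ := isPieceFamily_kernelPiece hodd hK hd hgrad hC
  obtain ⟨A', a, hA', ha, hσ₀⟩ := exists_isRegularSurface_sphere hm hκ₀ (by positivity) c hR
  set A := max (C * (4 + 2 ^ (m + 1))) A'
  have hA : 0 ≤ A := hA'.trans (le_max_right _ _)
  have hκ : IsPieceFamily m A κ := hκ₀.mono (le_max_left _ _)
  have hσ := hσ₀.mono (le_max_right _ _ : A' ≤ A)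
  set z := fun ω : sphere (0 : E) 1 => c + R • (ω : E) with hz_def
  set σ := (volume : Measure E).toSphere
  have hz : Continuous z := by fun_prop
  have hB : 0 ≤ 2 / a := by positivity
  obtain ⟨C₁, hC₁, hsmooth⟩ := exists_abs_sum_integral_smoothedKernel_le (E := E) hκ hz hσ hA hB hG
    (by positivity : 0 ≤ 8 * R)
  obtain ⟨C₂, hC₂, hcomp⟩ := exists_sum_abs_sub_smoothedKernel_le hκ hz hσ hA hB hR
  set M := C₁ + (C * 5 ^ (m + 1) + C₂)
  have hM : 0 ≤ M := by positivity
  refine ⟨M, hM, fun ε hε hεR P Q hP hQ hPQ => ?_⟩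
  set t := fun y => d y + ε
  have htc : Continuous t := hdc.add continuous_const
  have hεt : ∀ y, ε ≤ t y := fun y => le_add_of_nonneg_left (hd0 y)
  have ht0 : ∀ y, 0 < t y := fun y => hε.trans_le (hεt y)
  set D := {y | d y ≤ R}
  have hD : MeasurableSet D := (isClosed_le hdc continuous_const).measurableSet
  obtain ⟨p, hp⟩ := exists_isBumpFamily hz hσ ha htc ht0 hD fun y hy => by
    refine ⟨by have : d y ≤ R := hy; simp only [t]; linarith, ?_⟩
    obtain ⟨ω, hω⟩ := exists_norm_sub_eq_sphereDist c hR y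
    exact ⟨ω, hω.trans_le (le_add_of_nonneg_right hε.le)⟩
  obtain ⟨N, hN1, hN2⟩ : ∃ N : ℕ, 4 * R ≤ ε * 2 ^ N ∧ ε * 2 ^ N ≤ 8 * R := by
    obtain ⟨N, h1, h2⟩ := exists_nat_pow_near (x := 4 * R / ε) (y := 2)
      (by rw [le_div_iff₀ hε]; linarith) one_lt_two
    rw [le_div_iff₀ hε] at h1
    rw [div_lt_iff₀ hε, pow_succ] at h2
    exact ⟨N + 1, by rw [pow_succ]; linarith, by rw [pow_succ]; linarith⟩
  have hμr : ∀ (S : Set E) x r, 0 < r → (μ.restrict S).real (closedBall x r) ≤ G * r ^ m :=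
    fun S x r hr => by
      refine ENNReal.toReal_le_of_le_ofReal (by positivity) ?_
      exact (Measure.restrict_apply_le _ _).trans (hμ x r hr)
  have h1 := hsmooth t D p hp htc.measurable ε N hε hεt hN2 (μ.restrict P) (μ.restrict Q)
    (hμr P) (hμr Q)
  have hPreal : (μ.restrict P).real univ = μ.real P := by simp [Measure.real]
  have hQreal : (μ.restrict Q).real univ = μ.real Q := by simp [Measure.real]
  rw [hPreal, hQreal] at h1
  set S : ℕ → E → E → ℝ := fun j => smoothedKernel σ (κ (ε * 2 ^ j)) z p
  have hSm : ∀ j, Measurable (Function.uncurry (S j)) := fun j =>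
    measurable_smoothedKernel hp hκ hz hA (by positivity)
  have hSb : ∀ j, ∃ C, ∀ x y, |S j x y| ≤ C := fun j =>
    exists_abs_smoothedKernel_le hp hκ hA hB hε hεt (by positivity)
  choose CS hCS using hSb
  have hKm' : Measurable (Function.uncurry fun x y => truncKernel K ε (x - y)) :=
    (measurable_truncKernel hKm).comp measurable_sub
  have hKb : ∀ x y, |truncKernel K ε (x - y)| ≤ C / ε ^ m := fun x y =>
    abs_truncKernel_le hC hK hε (x - y)
  set I := ∫ x in Q, ∫ y in P, truncKernel K ε (x - y) ∂μ ∂μ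
  set H : E → E → ℝ := fun x y => truncKernel K ε (x - y) - ∑ j ∈ Finset.range N, S j x y
  have hIS : I - ∑ j ∈ Finset.range N, ∫ x in Q, ∫ y in P, S j x y ∂μ ∂μ =
      ∫ x in Q, ∫ y in P, H x y ∂μ ∂μ := by
    have hi : ∀ j x, Integrable (S j x) (μ.restrict P) := fun j x =>
      ((hSm j).comp measurable_prodMk_left).integrable_of_abs_le (hCS j x)
    have hi' : ∀ j, Integrable (fun x => ∫ y in P, S j x y ∂μ) (μ.restrict Q) := fun j =>
      (measurable_integral_right (hSm j)).integrable_of_abs_le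
        fun x => abs_integral_le_mul_real_univ ((abs_nonneg _).trans (hCS j x 0)) (hCS j x)
    rw [← integral_finsetSum _ fun j _ => hi' j, ← integral_sub]
    · refine integral_congr_ae (Eventually.of_forall fun x => ?_)
      show _ - _ = ∫ y in P, H x y ∂μ
      rw [← integral_finsetSum _ fun j _ => hi j x, ← integral_sub]
      · exact (hKm'.comp measurable_prodMk_left).integrable_of_abs_le (hKb x)
      · exact integrable_finsetSum _ fun j _ => hi j x
    · exact (measurable_integral_right hKm').integrable_of_abs_le
        fun x => abs_integral_le_mul_real_univ ((abs_nonneg _).trans (hKb x 0)) (hKb x)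
    · exact integrable_finsetSum _ fun j _ => hi' j
  have hHb : ∀ x ∈ Q, ∀ y ∈ P, |H x y| ≤
      M * (max (t x) (t y) / (max (t x) (t y) + ‖x - y‖) ^ (m + 1)) := by
    intro x hx y hy
    obtain ⟨hdx, hdy, hxR, hyR⟩ := hPQ x hx y hy
    have hsep : max (t x) (t y) ≤ ‖x - y‖ + ε :=
      max_le (add_le_add_left hdx _) (add_le_add_left hdy _)
    have hTR : max (t x) (t y) ≤ 2 * R :=
      max_le (by simp only [t]; linarith) (by simp only [t]; linarith)
    have hxy : ‖x - y‖ ≤ 4 * R := by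
      have h1 := (abs_le.1 hxR).2
      have h2 := (abs_le.1 hyR).2
      rw [show x - y = (x - c) - (y - c) by abel]
      linarith [norm_sub_le (x - c) (y - c)]
    have h2 := hcomp t D p hp ht0 ε N hε x hxR y hyR hTR hsep
    have h3 := abs_truncKernel_sub_sum_le hC hK hε (hxy.trans hN1)
      ((hεt x).trans (le_max_left _ (t y))) hsep
    have h4 : H x y = (truncKernel K ε (x - y) - ∑ j ∈ Finset.range N, κ (ε * 2 ^ j) (x - y)) +
        ∑ j ∈ Finset.range N, (κ (ε * 2 ^ j) (x - y) - S j x y) := by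
      rw [Finset.sum_sub_distrib]; simp only [H]; ring
    have h5 : 0 ≤ max (t x) (t y) / (max (t x) (t y) + ‖x - y‖) ^ (m + 1) := by
      have := (ht0 x).trans_le (le_max_left _ (t y))
      positivity
    rw [h4]
    refine (abs_add_le _ _).trans ?_
    calc _ ≤ _ := add_le_add h3 ((Finset.abs_sum_le_sum_abs _ _).trans h2)
      _ = (C * 5 ^ (m + 1) + C₂) *
          (max (t x) (t y) / (max (t x) (t y) + ‖x - y‖) ^ (m + 1)) := by ring
      _ ≤ _ := mul_le_mul_of_nonneg_right (le_add_of_nonneg_left hC₁) h5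
  set Z := ENNReal.ofReal M * (2 * ENNReal.ofReal (2 ^ (m + 1) * G) * μ Q +
    ∫⁻ x in Q, weightedPotential μ m d x ∂μ)
  have hZ : Z < ∞ := by
    refine ENNReal.mul_lt_top ENNReal.ofReal_lt_top (ENNReal.add_lt_top.2 ⟨?_, ?_⟩)
    · exact ENNReal.mul_lt_top (ENNReal.mul_lt_top (by simp) ENNReal.ofReal_lt_top)
        (measure_lt_top _ _)
    · exact (setLIntegral_le_lintegral _ _).trans_lt
        (lintegral_weightedPotential_lt_top hG hμ hdc.measurable hd0)
  have h2 : |∫ x in Q, ∫ y in P, H x y ∂μ ∂μ| ≤ Z.toReal := by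
    rw [← Real.norm_eq_abs, ← toReal_enorm]
    refine ENNReal.toReal_mono hZ.ne ?_
    calc _ ≤ ∫⁻ x in Q, ∫⁻ y in P, ‖H x y‖ₑ ∂μ ∂μ :=
          (enorm_integral_le_lintegral_enorm _).trans
            (lintegral_mono fun x => enorm_integral_le_lintegral_enorm _)
      _ ≤ ∫⁻ x in Q, ∫⁻ y in P, ENNReal.ofReal M * ENNReal.ofReal (max (t x) (t y) /
            (max (t x) (t y) + ‖x - y‖) ^ (m + 1)) ∂μ ∂μ := by
          refine setLIntegral_mono' hQ fun x hx => setLIntegral_mono' hP fun y hy => ?_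
          rw [← ENNReal.ofReal_mul hM, Real.enorm_eq_ofReal_abs]
          exact ENNReal.ofReal_le_ofReal (hHb x hx y hy)
      _ = ENNReal.ofReal M * ∫⁻ x in Q, ∫⁻ y in P, ENNReal.ofReal (max (t x) (t y) /
            (max (t x) (t y) + ‖x - y‖) ^ (m + 1)) ∂μ ∂μ := by
          simp only [lintegral_const_mul' _ _ ENNReal.ofReal_ne_top]
      _ ≤ Z := mul_le_mul_right
          (setLIntegral_setLIntegral_div_pow_le hG hμ hdc.measurable hd0 hε P Q) _
  have h3 : C₁ * √(μ.real P * μ.real Q) ≤ M * √(μ.real P * μ.real Q) := by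
    gcongr
    exact le_add_of_nonneg_right (by positivity)
  calc |I| = |(∑ j ∈ Finset.range N, ∫ x in Q, ∫ y in P, S j x y ∂μ ∂μ) +
        ∫ x in Q, ∫ y in P, H x y ∂μ ∂μ| := by rw [← hIS]; congr 1; ring
    _ ≤ _ := (abs_add_le _ _).trans (add_le_add (h1.trans h3) h2)

end NearSphere

/-! ### Existence of the limit -/

lemma exists_tendsto_of_forall_abs_sub_le {f : ℝ → ℝ}
    (h : ∀ η > 0, ∃ δ > 0, ∀ ε, 0 < ε → ε < δ → ∀ ε', 0 < ε' → ε' < δ → |f ε - f ε'| < η) :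
    ∃ l, Tendsto f (𝓝[>] 0) (𝓝 l) := by
  rw [← cauchy_map_iff_exists_tendsto, Metric.cauchy_iff]
  refine ⟨inferInstance, fun η hη => ?_⟩
  obtain ⟨δ, hδ, hf⟩ := h η hη
  refine ⟨f '' Ioo 0 δ, image_mem_map (Ioo_mem_nhdsGT hδ), ?_⟩
  rintro _ ⟨ε, hε, rfl⟩ _ ⟨ε', hε', rfl⟩
  exact hf ε hε.1 hε.2 ε' hε'.1 hε'.2

section TruncatedForm

variable {E : Type*} [NormedAddCommGroup E] [MeasurableSpace E]
  {μ : Measure E} {K : E → ℝ} {C ε : ℝ} {m : ℕ}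

/-- The truncated form on characteristic functions. -/
def truncForm (μ : Measure E) (K : E → ℝ) (ε : ℝ) (P Q : Set E) : ℝ :=
  ∫ x in Q, ∫ y in P, truncKernel K ε (x - y) ∂μ ∂μ

lemma truncForm_congr {ε' : ℝ} {P Q : Set E} (hP : MeasurableSet P) (hQ : MeasurableSet Q)
    (h : ∀ x ∈ Q, ∀ y ∈ P, ε < ‖x - y‖ ∧ ε' < ‖x - y‖) :
    truncForm μ K ε P Q = truncForm μ K ε' P Q :=
  setIntegral_congr_fun hQ fun x hx => setIntegral_congr_fun hP fun y hy => by
    simp only [truncKernel, if_pos (h x hx y hy).1, if_pos (h x hx y hy).2]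

variable [BorelSpace E] [SecondCountableTopology E] [IsFiniteMeasure μ]

lemma measurable_truncKernel_sub (hKm : Measurable K) :
    Measurable (Function.uncurry fun x y => truncKernel K ε (x - y)) :=
  (measurable_truncKernel hKm).comp measurable_sub

lemma integrable_truncKernel_sub (hC : 0 ≤ C) (hK : ∀ x, x ≠ 0 → |K x| ≤ C / ‖x‖ ^ m)
    (hKm : Measurable K) (hε : 0 < ε) (x : E) : Integrable (fun y => truncKernel K ε (x - y)) μ :=
  ((measurable_truncKernel_sub hKm).comp measurable_prodMk_left).integrable_of_abs_le
    fun _ => abs_truncKernel_le hC hK hε _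

lemma integrable_integral_truncKernel_sub (hC : 0 ≤ C) (hK : ∀ x, x ≠ 0 → |K x| ≤ C / ‖x‖ ^ m)
    (hKm : Measurable K) (hε : 0 < ε) (P : Set E) :
    Integrable (fun x => ∫ y in P, truncKernel K ε (x - y) ∂μ) μ :=
  (measurable_integral_right (measurable_truncKernel_sub hKm)).integrable_of_abs_le
    fun _ => abs_integral_le_mul_real_univ (by positivity) fun _ => abs_truncKernel_le hC hK hε _

lemma truncForm_inter_add_diff_left (hC : 0 ≤ C) (hK : ∀ x, x ≠ 0 → |K x| ≤ C / ‖x‖ ^ m)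
    (hKm : Measurable K) (hε : 0 < ε) (P Q : Set E) {S : Set E} (hS : MeasurableSet S) :
    truncForm μ K ε (P ∩ S) Q + truncForm μ K ε (P \ S) Q = truncForm μ K ε P Q := by
  unfold truncForm
  rw [← integral_add (integrable_integral_truncKernel_sub hC hK hKm hε _).integrableOn
    (integrable_integral_truncKernel_sub hC hK hKm hε _).integrableOn]
  congr 1; ext x
  exact integral_inter_add_sdiff hS (integrable_truncKernel_sub hC hK hKm hε x).integrableOn

lemma truncForm_inter_add_diff_right (hC : 0 ≤ C) (hK : ∀ x, x ≠ 0 → |K x| ≤ C / ‖x‖ ^ m)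
    (hKm : Measurable K) (hε : 0 < ε) (P Q : Set E) {S : Set E} (hS : MeasurableSet S) :
    truncForm μ K ε P (Q ∩ S) + truncForm μ K ε P (Q \ S) = truncForm μ K ε P Q :=
  integral_inter_add_sdiff hS (integrable_integral_truncKernel_sub hC hK hKm hε P).integrableOn

lemma truncForm_swap (hC : 0 ≤ C) (hK : ∀ x, x ≠ 0 → |K x| ≤ C / ‖x‖ ^ m)
    (hodd : ∀ x, x ≠ 0 → K (-x) = -K x)
    (hKm : Measurable K) (hε : 0 < ε) (P Q : Set E) :
    truncForm μ K ε P Q = -truncForm μ K ε Q P := by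
  unfold truncForm
  rw [integral_integral_swap_of_abs_le (measurable_truncKernel_sub hKm)
    fun x y => abs_truncKernel_le hC hK hε (x - y)]
  simp only [← integral_neg, ← truncKernel_neg hodd hε, neg_sub]

lemma truncForm_self (hC : 0 ≤ C) (hK : ∀ x, x ≠ 0 → |K x| ≤ C / ‖x‖ ^ m)
    (hodd : ∀ x, x ≠ 0 → K (-x) = -K x)
    (hKm : Measurable K) (hε : 0 < ε) (P : Set E) : truncForm μ K ε P P = 0 :=
  self_eq_neg.1 (truncForm_swap hC hK hodd hKm hε P P)

/-- The antisymmetry of the kernel reduces the form to pairs of sets separated by a sphere. -/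
lemma truncForm_eq_sub (hC : 0 ≤ C) (hK : ∀ x, x ≠ 0 → |K x| ≤ C / ‖x‖ ^ m)
    (hodd : ∀ x, x ≠ 0 → K (-x) = -K x)
    (hKm : Measurable K) (hε : 0 < ε) {P Q : Set E} (hP : MeasurableSet P) (hQ : MeasurableSet Q) :
    truncForm μ K ε P Q = truncForm μ K ε (P ∩ Q) (Q \ P) - truncForm μ K ε Q (P \ Q) := by
  rw [← truncForm_inter_add_diff_left hC hK hKm hε P Q hQ,
    ← truncForm_inter_add_diff_right hC hK hKm hε (P ∩ Q) Q hP, inter_comm Q P,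
    truncForm_self hC hK hodd hKm hε, zero_add, truncForm_swap hC hK hodd hKm hε (P \ Q) Q,
    sub_eq_add_neg]

end TruncatedForm

lemma measure_singleton_eq_zero {E : Type*} [PseudoMetricSpace E] [MeasurableSpace E]
    {μ : Measure E} {m : ℕ} {G : ℝ} (hm : m ≠ 0)
    (hμ : ∀ x r, 0 < r → μ (closedBall x r) ≤ ENNReal.ofReal (G * r ^ m)) (c : E) :
    μ {c} = 0 := by
  have h : Tendsto (fun r : ℝ => ENNReal.ofReal (G * r ^ m)) (𝓝[>] 0) (𝓝 0) := by
    have : Tendsto (fun r : ℝ => ENNReal.ofReal (G * r ^ m)) (𝓝 0)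
        (𝓝 (ENNReal.ofReal (G * 0 ^ m))) := (ENNReal.continuous_ofReal.comp (by fun_prop)).tendsto 0
    rw [zero_pow hm, mul_zero, ENNReal.ofReal_zero] at this
    exact this.mono_left nhdsWithin_le_nhds
  refine le_antisymm (ge_of_tendsto h ?_) zero_le
  filter_upwards [self_mem_nhdsWithin] with r hr
  exact (measure_mono (singleton_subset_iff.2 (mem_closedBall_self (le_of_lt hr)))).trans
    (hμ c r hr)

section Limit

variable {E : Type*} [NormedAddCommGroup E] [InnerProductSpace ℝ E] [FiniteDimensional ℝ E]
  [MeasurableSpace E] [BorelSpace E] {m : ℕ} {K : E → ℝ} {C G R : ℝ} {μ : Measure E}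
  [IsFiniteMeasure μ]

lemma exists_tendsto_truncForm_of_separated (hm : Module.finrank ℝ E = m + 1) (hm0 : m ≠ 0)
    (hC : 0 ≤ C)
    (hodd : ∀ x, x ≠ 0 → K (-x) = -K x) (hK : ∀ x, x ≠ 0 → |K x| ≤ C / ‖x‖ ^ m)
    (hd : ∀ x, x ≠ 0 → DifferentiableAt ℝ K x)
    (hgrad : ∀ x, x ≠ 0 → ‖fderiv ℝ K x‖ ≤ C / ‖x‖ ^ (m + 1)) (hKm : Measurable K) (hG : 0 ≤ G)
    (hμ : ∀ x r, 0 < r → μ (closedBall x r) ≤ ENNReal.ofReal (G * r ^ m)) (c : E) (R : ℝ)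
    {P Q : Set E} (hP : MeasurableSet P) (hQ : MeasurableSet Q) (hPc : P ⊆ closedBall c R)
    (hQc : Q ⊆ (closedBall c R)ᶜ) :
    ∃ l, Tendsto (fun ε => truncForm μ K ε P Q) (𝓝[>] 0) (𝓝 l) := by
  rcases le_or_gt R 0 with hR | hR
  · have hP0 : μ P = 0 := by
      refine measure_mono_null (hPc.trans fun y hy => ?_) (measure_singleton_eq_zero hm0 hμ c)
      rw [mem_closedBall] at hy
      exact dist_le_zero.1 (hy.trans hR)
    refine ⟨0, ?_⟩
    simp [truncForm, setIntegral_measure_zero _ hP0]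
  obtain ⟨M, hM, h⟩ := exists_abs_integral_truncKernel_le hm hC hodd hK hd hgrad hKm hG hμ c hR
  set d := sphereDist c R
  have hdc : Continuous d := continuous_sphereDist c R
  have hdQ : ∀ x ∈ Q, 0 < ‖x - c‖ - R := fun x hx => by
    have := hQc hx
    rw [mem_compl_iff, mem_closedBall_iff_norm, not_le] at this
    linarith
  have hdQ' : ∀ x ∈ Q, d x = ‖x - c‖ - R := fun x hx => abs_of_pos (hdQ x hx)
  have hdP : ∀ y ∈ P, d y = R - ‖y - c‖ := fun y hy => by
    have := hPc hy
    rw [mem_closedBall_iff_norm] at this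
    rw [show d y = |‖y - c‖ - R| from rfl, abs_of_nonpos (by linarith), neg_sub]
  have hsep : ∀ x ∈ Q, ∀ y ∈ P, d x + d y ≤ ‖x - y‖ := fun x hx y hy => by
    rw [hdQ' x hx, hdP y hy]
    have := norm_sub_norm_le (x - c) (y - c)
    rw [sub_sub_sub_cancel_right] at this
    linarith
  have hd0 : ∀ y, 0 ≤ d y := fun y => abs_nonneg _
  set U : ℕ → Set E := fun k => {x | d x < 1 / ((k : ℝ) + 1)}
  have hU : ∀ k, MeasurableSet (U k) := fun k =>
    (isOpen_lt hdc continuous_const).measurableSet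
  have hμ0 : Tendsto (fun k => μ (Q ∩ U k)) atTop (𝓝 0) := by
    have hanti : Antitone fun k => Q ∩ U k := fun i j hij =>
      inter_subset_inter_right _ fun x (hx : d x < _) =>
        show d x < _ from hx.trans_le (Nat.one_div_le_one_div hij)
    have h1 := tendsto_measure_iInter_atTop (μ := μ)
      (fun k => (hQ.inter (hU k)).nullMeasurableSet) hanti ⟨0, measure_ne_top _ _⟩
    rwa [show ⋂ k, Q ∩ U k = ∅ from ?_, measure_empty] at h1
    refine eq_empty_of_forall_notMem fun x hx => ?_
    rw [mem_iInter] at hx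
    have h2 : 0 < d x := by rw [hdQ' x (hx 0).1]; exact hdQ x (hx 0).1
    obtain ⟨k, hk⟩ := exists_nat_one_div_lt h2
    exact absurd (hx k).2 (not_lt.2 hk.le)
  set b : ℕ → ℝ := fun k => M * √(μ.real P * μ.real (Q ∩ U k)) +
    (ENNReal.ofReal M * (2 * ENNReal.ofReal (2 ^ (m + 1) * G) * μ (Q ∩ U k) +
      ∫⁻ x in Q ∩ U k, weightedPotential μ m d x ∂μ)).toReal
  have hb : Tendsto b atTop (𝓝 0) := by
    have h1 : Tendsto (fun k => μ.real (Q ∩ U k)) atTop (𝓝 0) :=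
      (ENNReal.tendsto_toReal zero_ne_top).comp hμ0
    have h2 : Tendsto (fun k => ∫⁻ x in Q ∩ U k, weightedPotential μ m d x ∂μ) atTop (𝓝 0) :=
      tendsto_setLIntegral_zero
        (lintegral_weightedPotential_lt_top hG hμ hdc.measurable hd0).ne hμ0
    have h3 : Tendsto (fun k => 2 * ENNReal.ofReal (2 ^ (m + 1) * G) * μ (Q ∩ U k)) atTop
        (𝓝 0) := by
      have h := ENNReal.Tendsto.const_mul (a := 2 * ENNReal.ofReal (2 ^ (m + 1) * G)) hμ0
        (Or.inr (ENNReal.mul_ne_top ofNat_ne_top ENNReal.ofReal_ne_top))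
      rwa [mul_zero] at h
    have h4 := (ENNReal.tendsto_toReal (by simp)).comp
      (ENNReal.Tendsto.const_mul (h3.add h2) (Or.inr (ENNReal.ofReal_ne_top (r := M))))
    have h5 := (((h1.const_mul (μ.real P)).sqrt).const_mul M).add h4
    simp only [add_zero, mul_zero, Real.sqrt_zero, ENNReal.toReal_zero] at h5
    exact h5
  refine exists_tendsto_of_forall_abs_sub_le fun η hη => ?_
  have hev : ∀ᶠ k : ℕ in atTop, b k < η / 2 ∧ 1 / ((k : ℝ) + 1) < R :=
    (hb.eventually_lt_const (half_pos hη)).and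
      (tendsto_one_div_add_atTop_nhds_zero_nat.eventually_lt_const hR)
  obtain ⟨k, hk, hkR⟩ := hev.exists
  have hδ : (0 : ℝ) < 1 / ((k : ℝ) + 1) := by positivity
  refine ⟨1 / ((k : ℝ) + 1), hδ, fun ε hε hεδ ε' hε' hεδ' => ?_⟩
  have hfar : truncForm μ K ε P (Q \ U k) = truncForm μ K ε' P (Q \ U k) := by
    refine truncForm_congr hP (hQ.diff (hU k)) fun x hx y hy => ?_
    have h1 : 1 / ((k : ℝ) + 1) ≤ d x := not_lt.1 hx.2
    have h2 := hsep x hx.1 y hy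
    have h3 := hd0 y
    exact ⟨by linarith, by linarith⟩
  have hnear : ∀ ε, 0 < ε → ε < 1 / ((k : ℝ) + 1) → |truncForm μ K ε P (Q ∩ U k)| < η / 2 := by
    intro ε hε hεδ
    refine (h ε hε (hεδ.trans hkR).le P (Q ∩ U k) hP (hQ.inter (hU k))
      fun x hx y hy => ?_).trans_lt hk
    have h2 := hsep x hx.1 y hy
    refine ⟨by linarith [hd0 y], by linarith [hd0 x],
      le_of_lt ((show d x < _ from hx.2).trans hkR), ?_⟩
    show d y ≤ R
    rw [hdP y hy]
    linarith [norm_nonneg (y - c)]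
  rw [← truncForm_inter_add_diff_right hC hK hKm hε P Q (hU k),
    ← truncForm_inter_add_diff_right hC hK hKm hε' P Q (hU k), hfar, add_sub_add_right_eq_sub]
  linarith [abs_sub (truncForm μ K ε P (Q ∩ U k)) (truncForm μ K ε' P (Q ∩ U k)),
    hnear ε hε hεδ, hnear ε' hε' hεδ']

theorem exists_tendsto_truncForm_closedBall (hm : Module.finrank ℝ E = m + 1) (hm0 : m ≠ 0)
    (hC : 0 ≤ C)
    (hodd : ∀ x, x ≠ 0 → K (-x) = -K x) (hK : ∀ x, x ≠ 0 → |K x| ≤ C / ‖x‖ ^ m)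
    (hd : ∀ x, x ≠ 0 → DifferentiableAt ℝ K x)
    (hgrad : ∀ x, x ≠ 0 → ‖fderiv ℝ K x‖ ≤ C / ‖x‖ ^ (m + 1)) (hKm : Measurable K) (hG : 0 ≤ G)
    (hμ : ∀ x r, 0 < r → μ (closedBall x r) ≤ ENNReal.ofReal (G * r ^ m)) (c c' : E) (R R' : ℝ) :
    ∃ l, Tendsto (fun ε => truncForm μ K ε (closedBall c R) (closedBall c' R')) (𝓝[>] 0) (𝓝 l) := by
  set P := closedBall c R
  set Q := closedBall c' R'
  have hP : MeasurableSet P := measurableSet_closedBall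
  have hQ : MeasurableSet Q := measurableSet_closedBall
  obtain ⟨l₁, h₁⟩ := exists_tendsto_truncForm_of_separated hm hm0 hC hodd hK hd hgrad hKm hG hμ c R
    (hP.inter hQ) (hQ.diff hP) inter_subset_left fun x hx => hx.2
  obtain ⟨l₂, h₂⟩ := exists_tendsto_truncForm_of_separated hm hm0 hC hodd hK hd hgrad hKm hG hμ c'
    R' hQ (hP.diff hQ) subset_rfl fun x hx => hx.2
  refine ⟨l₁ - l₂, (h₁.sub h₂).congr' ?_⟩
  filter_upwards [self_mem_nhdsWithin] with ε hε
  exact (truncForm_eq_sub hC hK hodd hKm hε hP hQ).symm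

end Limit

lemma trunc_eq_integral_truncKernel {n : ℕ} (μ : Measure (EuclideanSpace ℝ (Fin n)))
    (K : EuclideanSpace ℝ (Fin n) → ℝ) (ε : ℝ)
    (g : EuclideanSpace ℝ (Fin n) → ℝ) (x : EuclideanSpace ℝ (Fin n)) :
    trunc μ K ε g x = ∫ y, truncKernel K ε (x - y) * g y ∂μ := by
  rw [trunc, ← integral_indicator measurableSet_closedBall.compl]
  congr 1; ext y
  by_cases h : ε < ‖x - y‖
  · rw [indicator_of_mem (by simpa [dist_comm y x, dist_eq_norm] using h), truncKernel,
      if_pos h]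
  · rw [indicator_of_notMem (by simpa [dist_comm y x, dist_eq_norm] using h),
      truncKernel, if_neg h, zero_mul]

lemma integral_trunc_mul_eq_sum {n m : ℕ} {μ : Measure (EuclideanSpace ℝ (Fin n))}
    [IsFiniteMeasure μ] {K : EuclideanSpace ℝ (Fin n) → ℝ} {C : ℝ} (hC : 0 ≤ C)
    (hK : ∀ x, x ≠ 0 → |K x| ≤ C / ‖x‖ ^ m) (hKm : Measurable K) {ε : ℝ} (hε : 0 < ε)
    {ι ι' : Type*} [Fintype ι] [Fintype ι'] (a : ι → ℝ) (b : ι' → ℝ)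
    {P : ι → Set (EuclideanSpace ℝ (Fin n))} {Q : ι' → Set (EuclideanSpace ℝ (Fin n))}
    (hP : ∀ i, MeasurableSet (P i)) (hQ : ∀ j, MeasurableSet (Q j)) :
    ∫ x, trunc μ K ε (fun y => ∑ i, a i * (P i).indicator (fun _ => (1 : ℝ)) y) x *
      (∑ j, b j * (Q j).indicator (fun _ => (1 : ℝ)) x) ∂μ =
      ∑ i, ∑ j, a i * b j * truncForm μ K ε (P i) (Q j) := by
  have h1 : ∀ x, trunc μ K ε (fun y => ∑ i, a i * (P i).indicator (fun _ => (1 : ℝ)) y) x =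
      ∑ i, a i * ∫ y in P i, truncKernel K ε (x - y) ∂μ := fun x => by
    have hpt : ∀ i y, truncKernel K ε (x - y) * (a i * (P i).indicator (fun _ => (1 : ℝ)) y) =
        a i * (P i).indicator (fun y => truncKernel K ε (x - y)) y := fun i y => by
      by_cases hy : y ∈ P i <;> simp [hy, mul_comm]
    rw [trunc_eq_integral_truncKernel]
    simp only [Finset.mul_sum, hpt]
    rw [integral_finsetSum]
    · simp only [integral_const_mul, integral_indicator (hP _)]
    · exact fun i _ =>
        ((integrable_truncKernel_sub hC hK hKm hε x).indicator (hP i)).const_mul _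
  have hpt : ∀ x, (∑ i, a i * ∫ y in P i, truncKernel K ε (x - y) ∂μ) *
      (∑ j, b j * (Q j).indicator (fun _ => (1 : ℝ)) x) =
      ∑ i, ∑ j, a i * b j * (Q j).indicator
        (fun x => ∫ y in P i, truncKernel K ε (x - y) ∂μ) x := fun x => by
    rw [Finset.sum_mul_sum]
    refine Finset.sum_congr rfl fun i _ => Finset.sum_congr rfl fun j _ => ?_
    by_cases hx : x ∈ Q j
    · simp only [indicator_of_mem hx]; ring
    · simp only [indicator_of_notMem hx, mul_zero]
  have hi : ∀ i j, Integrable (fun x => a i * b j * (Q j).indicator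
      (fun x => ∫ y in P i, truncKernel K ε (x - y) ∂μ) x) μ := fun i j =>
    ((integrable_integral_truncKernel_sub hC hK hKm hε (P i)).indicator (hQ j)).const_mul _
  simp only [h1, hpt]
  rw [integral_finsetSum _ fun i _ => integrable_finsetSum _ fun j _ => hi i j]
  refine Finset.sum_congr rfl fun i _ => ?_
  rw [integral_finsetSum _ fun j _ => hi i j]
  refine Finset.sum_congr rfl fun j _ => ?_
  rw [integral_const_mul, integral_indicator (hQ j), truncForm]

/-- If `μ ∈ Δ` is a finite measure on `ℝⁿ` (`n ≥ 2`) and `K ∈ 𝒦`, then for `f`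
and `g` finite linear combinations of characteristic functions of closed balls, the limit
`lim_{ε→0} ∫ T^ε_{μ,K} f · g dμ` exists and is finite. -/
theorem statement6 (n : ℕ) (hn : 2 ≤ n)
    (μ : Measure (EuclideanSpace ℝ (Fin n))) [IsFiniteMeasure μ]
    (Cμ : ℝ)
    (hμΔ : ∀ (x : EuclideanSpace ℝ (Fin n)) (r : ℝ), 0 < r →
      μ (closedBall x r) ≤ ENNReal.ofReal (Cμ * r ^ (n - 1)))
    (K : EuclideanSpace ℝ (Fin n) → ℝ) (C₀ C₁ : ℝ)
    (hK_diff : ContDiffOn ℝ 1 K {0}ᶜ)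
    (hK_anti : ∀ x : EuclideanSpace ℝ (Fin n), x ≠ 0 → K (-x) = -K x)
    (hK_size : ∀ x : EuclideanSpace ℝ (Fin n), x ≠ 0 →
      |K x| ≤ C₀ * ‖x‖ ^ (-((n : ℝ) - 1)))
    (hK_grad : ∀ x : EuclideanSpace ℝ (Fin n), x ≠ 0 →
      ‖fderiv ℝ K x‖ ≤ C₁ * ‖x‖ ^ (-(n : ℝ)))
    (l k : ℕ) (a : Fin l → ℝ) (b : Fin k → ℝ)
    (c : Fin l → EuclideanSpace ℝ (Fin n)) (r : Fin l → ℝ)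
    (c' : Fin k → EuclideanSpace ℝ (Fin n)) (r' : Fin k → ℝ) :
    ∃ lim : ℝ, Tendsto (fun ε : ℝ =>
        ∫ x, trunc μ K ε
            (fun y => ∑ i, a i * (closedBall (c i) (r i)).indicator (fun _ => (1 : ℝ)) y) x *
          (∑ j, b j * (closedBall (c' j) (r' j)).indicator (fun _ => (1 : ℝ)) x) ∂μ)
      (𝓝[>] 0) (𝓝 lim) := by
  obtain ⟨m, rfl⟩ : ∃ m, n = m + 1 := ⟨n - 1, by omega⟩
  have hm0 : m ≠ 0 := by omega
  simp only [Nat.add_sub_cancel] at hμΔ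
  set C := max |C₀| |C₁|
  have hC : 0 ≤ C := (abs_nonneg _).trans (le_max_left _ _)
  have hK : ∀ x, x ≠ 0 → |K x| ≤ C / ‖x‖ ^ m := fun x hx => by
    refine (hK_size x hx).trans ?_
    rw [Nat.cast_succ, add_sub_cancel_right, Real.rpow_neg (norm_nonneg x), Real.rpow_natCast,
      ← div_eq_mul_inv]
    gcongr
    exact (le_abs_self _).trans (le_max_left _ _)
  have hgrad : ∀ x, x ≠ 0 → ‖fderiv ℝ K x‖ ≤ C / ‖x‖ ^ (m + 1) := fun x hx => by
    refine (hK_grad x hx).trans ?_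
    rw [Real.rpow_neg (norm_nonneg x), Real.rpow_natCast, ← div_eq_mul_inv]
    gcongr
    exact (le_abs_self _).trans (le_max_right _ _)
  have hd : ∀ x, x ≠ 0 → DifferentiableAt ℝ K x := fun x hx =>
    (hK_diff.differentiableOn one_ne_zero).differentiableAt
      (isOpen_compl_singleton.mem_nhds hx)
  have hKm : Measurable K := measurable_of_continuousOn_compl_singleton 0 hK_diff.continuousOn
  have hμ : ∀ x r, 0 < r → μ (closedBall x r) ≤ ENNReal.ofReal (|Cμ| * r ^ m) := fun x r hr =>
    (hμΔ x r hr).trans (ENNReal.ofReal_le_ofReal (by gcongr; exact le_abs_self Cμ))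
  choose L hL using fun i j => exists_tendsto_truncForm_closedBall
    (finrank_euclideanSpace_fin (𝕜 := ℝ) (n := m + 1)) hm0 hC hK_anti hK hd hgrad hKm
    (abs_nonneg Cμ) hμ (c i) (c' j) (r i) (r' j)
  refine ⟨∑ i, ∑ j, a i * b j * L i j, Tendsto.congr' ?_ (tendsto_finsetSum _ fun i _ =>
    tendsto_finsetSum _ fun j _ => (hL i j).const_mul (a i * b j))⟩
  filter_upwards [self_mem_nhdsWithin] with ε hε
  exact (integral_trunc_mul_eq_sum hC hK hKm hε a b (fun _ => measurableSet_closedBall)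
    fun _ => measurableSet_closedBall).symm
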